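/- arXiv:1611.08646 — 6 statements merged into one kernel-verified Lean document; each statement's English description precedes it below -/
import Mathlib

section
/- Let ε ∈ {−2, −1, 1, 2} and let A, K be positive integers satisfying K ≥ 30.03·|ε|³·(A+1) and either A ≥ 3 or A = |ε| = 2. Put N = (A² + A)K/2 + εA, θ₁ = √(1 − εA/N), θ₂ = √(1 + ε/N), and λ = 1 + log(20(A+1)N) / log(1.338·N² / (|ε|³·A(A+1))). Then λ < 2 and for all integers p₁, p₂, q with q > 0 one has max{|θ₁ − p₁/q|, |θ₂ − p₂/q|} > (2.838·10²⁸·(A+1)·N)⁻¹ · q^(−λ). -/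
namespace HermitePade

open PowerSeries

/-- The generalized binomial coefficient `α (α - 1) ⋯ (α - h + 1) / h!`. -/
noncomputable def binom (α : ℝ) (h : ℕ) : ℝ := ∏ i ∈ Finset.range h, (α - i) / (i + 1)

@[simp] lemma binom_zero (α : ℝ) : binom α 0 = 1 := by simp [binom]

lemma binom_succ (α : ℝ) (h : ℕ) : binom α (h + 1) = binom α h * ((α - h) / (h + 1)) := by
  simp only [binom, Finset.prod_range_succ]

lemma binom_succ_mul (α : ℝ) (h : ℕ) : binom α (h + 1) * (h + 1) = binom α h * (α - h) := by
  rw [binom_succ]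
  have : (h : ℝ) + 1 ≠ 0 := by positivity
  field_simp

lemma binom_pascal (α : ℝ) (h : ℕ) :
    binom (α + 1) (h + 1) = binom α (h + 1) + binom α h := by
  induction h with
  | zero => simp [binom_succ]
  | succ h ih =>
    rw [binom_succ (α + 1), ih, binom_succ α (h + 1), binom_succ α h]
    have h1 : (h : ℝ) + 1 ≠ 0 := by positivity
    have h2 : (h : ℝ) + 1 + 1 ≠ 0 := by positivity
    push_cast
    field_simp
    ring

lemma four_pow_mul_binom_half (h : ℕ) :
    (4 : ℝ) ^ (h + 1) * binom (1 / 2) (h + 1) = (-1) ^ h * 2 * catalan h := by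
  induction h with
  | zero => norm_num [binom_succ]
  | succ h ih =>
    have e1 := succ_mul_catalan_eq_centralBinom h
    have e2 := succ_mul_catalan_eq_centralBinom (h + 1)
    have e3 := Nat.succ_mul_centralBinom_succ h
    rw [← e1, ← e2] at e3
    have e4 : ((h : ℝ) + 1) * ((h + 1 + 1) * catalan (h + 1))
        = 2 * (2 * h + 1) * ((h + 1) * catalan h) := by exact_mod_cast e3
    have h1 : (h : ℝ) + 1 ≠ 0 := by positivity
    have h2 : (h : ℝ) + 1 + 1 ≠ 0 := by positivity
    have e5 : (catalan (h + 1) : ℝ) = 2 * (2 * h + 1) * catalan h / (h + 1 + 1) := by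
      field_simp
      exact mul_left_cancel₀ h1 (by linarith)
    rw [binom_succ, pow_succ, e5]
    calc _ = (4 : ℝ) ^ (h + 1) * binom (1 / 2) (h + 1)
          * (4 * ((1 / 2 - (h + 1 : ℕ)) / ((h + 1 : ℕ) + 1))) := by ring
      _ = _ := by
        rw [ih]
        push_cast
        field_simp
        ring

lemma four_pow_mul_binom_add_half (k h : ℕ) :
    (4 : ℝ) ^ h * binom (k + 1 / 2) h ∈ (Int.castRingHom ℝ).range := by
  induction k generalizing h with
  | zero =>
    cases h with
    | zero => simp
    | succ h =>
      refine ⟨(-1) ^ h * 2 * catalan h, ?_⟩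
      have := four_pow_mul_binom_half h
      simp only [Nat.cast_zero, zero_add, this]
      simp
  | succ k ih =>
    cases h with
    | zero => simp
    | succ h =>
      have e : ((k + 1 : ℕ) : ℝ) + 1 / 2 = (k + 1 / 2 : ℝ) + 1 := by push_cast; ring
      rw [e, binom_pascal, mul_add]
      refine add_mem (ih _) ?_
      rw [pow_succ, mul_right_comm]
      exact mul_mem (ih h) ⟨4, by simp⟩

lemma binom_add_half_nonneg (k h : ℕ) (hh : h ≤ k + 1) : 0 ≤ binom (k + 1 / 2) h := by
  refine Finset.prod_nonneg fun i hi => ?_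
  have : (i : ℝ) ≤ k := by
    exact_mod_cast Nat.lt_succ_iff.mp ((Finset.mem_range.mp hi).trans_le hh)
  have : (0 : ℝ) ≤ k + 1 / 2 - i := by linarith
  positivity

lemma binom_natCast (n h : ℕ) (hh : h ≤ n) : binom n h = n.choose h := by
  induction h with
  | zero => simp
  | succ h ih =>
    have e := Nat.choose_succ_right_eq n h
    have h1 : (h : ℝ) + 1 ≠ 0 := by positivity
    have e' : (n.choose (h + 1) : ℝ) * (h + 1) = n.choose h * (n - h) := by
      rw [← Nat.cast_sub (by omega)]
      exact_mod_cast e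
    apply mul_right_cancel₀ h1
    rw [binom_succ_mul, ih (by omega), e']

lemma binom_add_half_le_choose (k h : ℕ) (hh : h ≤ k + 1) :
    binom (k + 1 / 2) h ≤ (k + 1).choose h := by
  rw [← binom_natCast _ _ hh]
  refine Finset.prod_le_prod (fun i hi => ?_) fun i hi => ?_
  · have : (i : ℝ) ≤ k := by
      exact_mod_cast Nat.lt_succ_iff.mp ((Finset.mem_range.mp hi).trans_le hh)
    have : (0 : ℝ) ≤ k + 1 / 2 - i := by linarith
    positivity
  · push_cast
    gcongr
    norm_num

lemma abs_binom_three_mul_le (k : ℕ) : |binom (k + 1 / 2) (3 * k)| ≤ (4 / 27) ^ k := by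
  induction k with
  | zero => simp
  | succ k ih =>
    have key : binom ((k + 1 : ℕ) + 1 / 2) (3 * (k + 1)) = binom (k + 1 / 2) (3 * k) *
        ((k + 3 / 2) * (1 / 2 - 2 * k) * (-1 / 2 - 2 * k) /
          ((3 * k + 1) * (3 * k + 2) * (3 * k + 3))) := by
      simp only [binom, Finset.prod_div_distrib]
      have : 3 * (k + 1) = 3 * k + 2 + 1 := by ring
      rw [this, Finset.prod_range_succ' (fun i : ℕ => ((k + 1 : ℕ) : ℝ) + 1 / 2 - i)]
      have e : ∀ i : ℕ, ((k + 1 : ℕ) : ℝ) + 1 / 2 - (i + 1 : ℕ) = k + 1 / 2 - i := by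
        intro i; push_cast; ring
      simp only [e]
      simp only [Finset.prod_range_succ]
      rw [div_mul_div_comm]
      congr 1
      · push_cast; ring
      · push_cast; ring
    rw [key, abs_mul, pow_succ]
    have hk : (0 : ℝ) ≤ k := k.cast_nonneg
    refine mul_le_mul ih ?_ (abs_nonneg _) (by positivity)
    rw [abs_div, abs_of_pos (by positivity : (0 : ℝ) < (3 * k + 1) * (3 * k + 2) * (3 * k + 3)),
      div_le_iff₀ (by positivity), abs_le]
    have hk2 : (0 : ℝ) ≤ k ^ 2 := by positivity
    have hk3 : (0 : ℝ) ≤ k ^ 3 := by positivity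
    constructor <;> nlinarith

/-- The Taylor series of `(y + x X) ^ (k + 1 / 2) / √y`, truncated after degree `k`. -/
noncomputable def sqrtSeries (k : ℕ) (x y : ℝ) : PowerSeries ℝ :=
  .mk fun h => if h ≤ k then binom (k + 1 / 2) h * y ^ (k - h) * x ^ h else 0

/-- The power series inverse of `d + X`. -/
noncomputable def invLin (d : ℝ) : PowerSeries ℝ := (C d + X)⁻¹

lemma invLin_mul {d : ℝ} (hd : d ≠ 0) : invLin d * (C d + X) = 1 :=
  PowerSeries.inv_mul_cancel _ (by simpa using hd)

lemma coeff_zero_mul_invLin {d : ℝ} (hd : d ≠ 0) (S : PowerSeries ℝ) :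
    coeff 0 (S * invLin d) * d = coeff 0 S := by
  conv_rhs => rw [← mul_one S, ← invLin_mul hd, ← mul_assoc]
  simp [mul_add]

lemma coeff_succ_mul_invLin {d : ℝ} (hd : d ≠ 0) (S : PowerSeries ℝ) (h : ℕ) :
    coeff (h + 1) (S * invLin d) * d + coeff h (S * invLin d) = coeff (h + 1) S := by
  conv_rhs => rw [← mul_one S, ← invLin_mul hd, ← mul_assoc]
  rw [mul_add, map_add, coeff_mul_C, coeff_succ_mul_X]

lemma sum_abs_coeff_mul_invLin_le {S : PowerSeries ℝ} {r d B : ℝ} (hr : 0 ≤ r) (hrd : r < |d|)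
    (hS : ∀ n, ∑ h ∈ Finset.range n, |coeff h S| * r ^ h ≤ B) (n : ℕ) :
    ∑ h ∈ Finset.range n, |coeff h (S * invLin d)| * r ^ h ≤ B / (|d| - r) := by
  have hd : d ≠ 0 := abs_pos.mp (hr.trans_lt hrd)
  rw [le_div_iff₀ (sub_pos.mpr hrd)]
  set v := fun h => |coeff h (S * invLin d)| * r ^ h with hv
  have hv0 : ∀ h, 0 ≤ v h := fun h => by positivity
  have key : ∀ n, |d| * ∑ h ∈ Finset.range (n + 1), v h ≤
      ∑ h ∈ Finset.range (n + 1), |coeff h S| * r ^ h + r * ∑ h ∈ Finset.range n, v h := by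
    intro n
    induction n with
    | zero =>
      have := coeff_zero_mul_invLin hd S
      simp only [hv, zero_add, Finset.sum_range_one, Finset.sum_range_zero, pow_zero, mul_one,
        mul_zero, add_zero, ← this, abs_mul]
      rw [mul_comm]
    | succ n ih =>
      rw [Finset.sum_range_succ, mul_add, Finset.sum_range_succ _ (n + 1),
        Finset.sum_range_succ v n, mul_add]
      have : |d| * v (n + 1) ≤ |coeff (n + 1) S| * r ^ (n + 1) + r * v n := by
        have e := coeff_succ_mul_invLin hd S n
        have e' : coeff (n + 1) (S * invLin d) * d
          = coeff (n + 1) S - coeff n (S * invLin d) := by linarith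
        have : |coeff (n + 1) (S * invLin d)| * |d|
            ≤ |coeff (n + 1) S| + |coeff n (S * invLin d)| := by
          rw [← abs_mul, e']
          exact abs_sub _ _
        calc |d| * v (n + 1) = |coeff (n + 1) (S * invLin d)| * |d| * r ^ (n + 1) := by
              simp only [hv]; ring
          _ ≤ (|coeff (n + 1) S| + |coeff n (S * invLin d)|) * r ^ (n + 1) := by gcongr
          _ = _ := by simp only [hv]; ring
      have h2 := ih
      rw [Finset.sum_range_succ v n, mul_add] at h2
      linarith
  have h1 := key n
  have h2 := hS (n + 1)
  have h3 : ∑ h ∈ Finset.range n, v h ≤ ∑ h ∈ Finset.range (n + 1), v h := by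
    rw [Finset.sum_range_succ]; linarith [hv0 n]
  nlinarith [mul_le_mul_of_nonneg_left h3 (abs_nonneg d)]

lemma sum_abs_coeff_mul_invLin_pow_le {S : PowerSeries ℝ} {r d B : ℝ} (hr : 0 ≤ r)
    (hrd : r < |d|) (hS : ∀ n, ∑ h ∈ Finset.range n, |coeff h S| * r ^ h ≤ B) (m n : ℕ) :
    ∑ h ∈ Finset.range n, |coeff h (S * invLin d ^ m)| * r ^ h ≤ B / (|d| - r) ^ m := by
  induction m generalizing n with
  | zero => simpa using hS n
  | succ m ih =>
    have := sum_abs_coeff_mul_invLin_le hr hrd ih n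
    rwa [mul_assoc, ← pow_succ, div_div, ← pow_succ] at this

lemma sum_abs_coeff_sqrtSeries_le (k : ℕ) {x y r : ℝ} (hx : 0 ≤ x) (hy : 0 < y) (hr : 0 ≤ r)
    (n : ℕ) : ∑ h ∈ Finset.range n, |coeff h (sqrtSeries k x y)| * r ^ h
      ≤ (y + x * r) ^ (k + 1) / y := by
  have nonneg : ∀ h, 0 ≤ |coeff h (sqrtSeries k x y)| * r ^ h := fun h => by positivity
  have step : ∑ h ∈ Finset.range n, |coeff h (sqrtSeries k x y)| * r ^ h ≤
      ∑ h ∈ Finset.range (k + 1), |coeff h (sqrtSeries k x y)| * r ^ h := by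
    rw [← Finset.sum_filter_ne_zero]
    refine Finset.sum_le_sum_of_subset_of_nonneg (fun h hh => ?_) fun h _ _ => nonneg h
    have hne := (Finset.mem_filter.mp hh).2
    by_contra hh
    apply hne
    have : ¬ h ≤ k := by simpa [Nat.lt_succ_iff] using hh
    simp [sqrtSeries, this]
  refine step.trans ?_
  rw [add_comm y, add_pow, Finset.sum_range_succ _ (k + 1), le_div_iff₀ hy, Finset.sum_mul]
  refine le_add_of_le_of_nonneg (Finset.sum_le_sum fun h hh => ?_) (by positivity)
  have hk : h ≤ k := Nat.lt_succ_iff.mp (Finset.mem_range.mp hh)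
  have hb := binom_add_half_nonneg k h (by omega)
  have hb' := binom_add_half_le_choose k h (by omega)
  rw [sqrtSeries, coeff_mk, if_pos hk, abs_of_nonneg (by positivity)]
  have : k + 1 - h = k - h + 1 := by omega
  rw [this]
  calc _ = binom (k + 1 / 2) h * (y ^ (k - h + 1) * x ^ h * r ^ h) := by ring
    _ ≤ (k + 1).choose h * (y ^ (k - h + 1) * x ^ h * r ^ h) := by gcongr
    _ = _ := by ring

lemma abs_coeff_le {k m n n' : ℕ} {x y r d d' : ℝ} (hx : 0 ≤ x) (hy : 0 < y) (hr : 0 < r)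
    (hd : r < |d|) (hd' : r < |d'|) :
    |coeff m (sqrtSeries k x y * invLin d ^ n * invLin d' ^ n')| * r ^ m ≤
      (y + x * r) ^ (k + 1) / y / (|d| - r) ^ n / (|d'| - r) ^ n' := by
  refine le_trans ?_ (sum_abs_coeff_mul_invLin_pow_le hr.le hd'
    (sum_abs_coeff_mul_invLin_pow_le hr.le hd
      (sum_abs_coeff_sqrtSeries_le k hx hy hr.le) n) n' (m + 1))
  exact Finset.single_le_sum (f := fun h =>
    |coeff h (sqrtSeries k x y * invLin d ^ n * invLin d' ^ n')| * r ^ h)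
    (fun h _ => by positivity) (Finset.self_mem_range_succ m)

lemma coeff_invLin {d : ℝ} (hd : d ≠ 0) (h : ℕ) :
    d ^ (1 + h) * coeff h (invLin d) = (-1) ^ h := by
  induction h with
  | zero =>
    have := coeff_zero_mul_invLin hd 1
    rw [one_mul] at this
    simp only [add_zero, pow_one, pow_zero, mul_comm d, this]
    simp
  | succ h ih =>
    have := coeff_succ_mul_invLin hd 1 h
    rw [one_mul, coeff_one, if_neg (by omega)] at this
    rw [pow_succ, ← ih, ← add_assoc, pow_succ]
    linear_combination d ^ (1 + h) * this

lemma pow_mul_coeff_invLin_pow {d : ℝ} (hd : d ≠ 0) (n h : ℕ) :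
    d ^ (n + h) * coeff h (invLin d ^ n) ∈ (Int.castRingHom ℝ).range := by
  induction n generalizing h with
  | zero =>
    rw [pow_zero, coeff_one]
    split_ifs with hh
    · simp [hh]
    · simp
  | succ n ih =>
    rw [pow_succ, coeff_mul, Finset.mul_sum]
    refine sum_mem fun p hp => ?_
    have hp' := Finset.HasAntidiagonal.mem_antidiagonal.mp hp
    have e : n + 1 + h = (n + p.1) + (1 + p.2) := by omega
    rw [e, pow_add, mul_mul_mul_comm]
    refine mul_mem (ih _) ?_
    rw [coeff_invLin hd]
    exact ⟨(-1) ^ p.2, by simp⟩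

lemma pow_mul_coeff_mem_int {k m s t : ℕ} {x y M N E d d' : ℝ} (hd : d ≠ 0) (hd' : d' ≠ 0)
    (hm : m + s + t = k) (hNx : N * x = 1) (hNy : N * y = M)
    (hE : ∃ g : ℤ, E = 4 * (d * d') * g) (hu : ∃ u : ℤ, 4 * M = d * u)
    (hu' : ∃ u : ℤ, 4 * M = d' * u) :
    (E * N) ^ k * coeff m (sqrtSeries k x y * invLin d ^ (k + s) * invLin d' ^ (k + t))
      ∈ (Int.castRingHom ℝ).range := by
  obtain ⟨g, rfl⟩ := hE
  obtain ⟨u, hu⟩ := hu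
  obtain ⟨u', hu'⟩ := hu'
  rw [coeff_mul, Finset.mul_sum]
  refine sum_mem fun p hp => ?_
  rw [coeff_mul, Finset.sum_mul, Finset.mul_sum]
  refine sum_mem fun q hq => ?_
  rw [Finset.HasAntidiagonal.mem_antidiagonal] at hp hq
  have hk : k = q.1 + (s + q.2) + (t + p.2) := by omega
  have hkq : k - q.1 = (s + q.2) + (t + p.2) := by omega
  have h1 := four_pow_mul_binom_add_half k q.1
  have h2 := pow_mul_coeff_invLin_pow hd (k + s) q.2
  have h3 := pow_mul_coeff_invLin_pow hd' (k + t) p.2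
  have key : (4 * (d * d') * g * N) ^ k * (coeff q.1 (sqrtSeries k x y)
      * coeff q.2 (invLin d ^ (k + s)) * coeff p.2 (invLin d' ^ (k + t))) =
      (4 ^ q.1 * binom (k + 1 / 2) q.1) * (g : ℝ) ^ k * (u : ℝ) ^ (s + q.2)
        * (u' : ℝ) ^ (t + p.2) * (d ^ (k + s + q.2) * coeff q.2 (invLin d ^ (k + s)))
        * (d' ^ (k + t + p.2) * coeff p.2 (invLin d' ^ (k + t))) := by
    rw [sqrtSeries, coeff_mk, if_pos (by omega), hkq]
    have e4 : (4 : ℝ) ^ k * (N ^ k * (y ^ (s + q.2 + (t + p.2)) * x ^ q.1)) =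
        4 ^ q.1 * ((d * u) ^ (s + q.2) * (d' * u') ^ (t + p.2)) := by
      rw [← hu, ← hu', ← hNy]
      calc _ = 4 ^ k * ((N * x) ^ q.1 * (N * y) ^ (s + q.2 + (t + p.2))) := by
            conv_lhs => rw [hk]
            conv_rhs => rw [hk]
            ring
        _ = _ := by
            conv_lhs => rw [hk]
            rw [hNx]
            ring
    calc _ = (4 : ℝ) ^ k * (N ^ k * (y ^ (s + q.2 + (t + p.2)) * x ^ q.1)) * ((d * d' * g) ^ k
          * binom (k + 1 / 2) q.1
          * (coeff q.2 (invLin d ^ (k + s)) * coeff p.2 (invLin d' ^ (k + t)))) := by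
          simp only [mul_pow]; ring
      _ = _ := by
          rw [e4]
          simp only [mul_pow, pow_add]
          ring
  have hz : ∀ z : ℤ, (z : ℝ) ∈ (Int.castRingHom ℝ).range := fun z => ⟨z, rfl⟩
  rw [key]
  exact mul_mem (mul_mem (mul_mem (mul_mem (mul_mem h1 (pow_mem (hz g) _)) (pow_mem (hz u) _))
    (pow_mem (hz u') _)) h2) h3

/-- The Taylor series at `a j` of `∏ (z - a l) ^ (-n l)`, the product being over `l ≠ j`. -/
noncomputable def invProd (a : Fin 3 → ℝ) (n : Fin 3 → ℕ) (j : Fin 3) : PowerSeries ℝ :=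
  invLin (a j - a (j + 1)) ^ n (j + 1) * invLin (a j - a (j + 2)) ^ n (j + 2)

lemma coeff_trunc_mul {n m : ℕ} (hm : m < n) (f g : PowerSeries ℝ) :
    coeff m ((trunc n f : PowerSeries ℝ) * g) = coeff m (f * g) := by
  rw [coeff_mul, coeff_mul]
  refine Finset.sum_congr rfl fun p hp => ?_
  rw [Finset.HasAntidiagonal.mem_antidiagonal] at hp
  rw [Polynomial.coeff_coe, coeff_trunc, if_pos (by omega)]

lemma coeff_taylor_of_natDegree_le {B : Polynomial ℝ} {m : ℕ} (hB : B.natDegree ≤ m) (r : ℝ) :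
    (Polynomial.taylor r B).coeff m = B.coeff m := by
  rcases hB.eq_or_lt with h | h
  · rw [← h, Polynomial.coeff_taylor_natDegree, Polynomial.leadingCoeff]
  · rw [Polynomial.coeff_eq_zero_of_natDegree_lt h,
      Polynomial.coeff_eq_zero_of_natDegree_lt (by rwa [Polynomial.natDegree_taylor])]

lemma ne_add_one (j : Fin 3) : j + 1 ≠ j := by revert j; decide

lemma ne_add_two (j : Fin 3) : j + 2 ≠ j := by revert j; decide

lemma eq_add_one_or_add_two {i j : Fin 3} : j ≠ i → j = i + 1 ∨ j = i + 2 := by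
  revert i j; decide

lemma sum_eq_add_add {M : Type*} [AddCommMonoid M] (f : Fin 3 → M) (j : Fin 3) :
    ∑ i, f i = f j + f (j + 1) + f (j + 2) := by
  rw [Fin.sum_univ_three]
  fin_cases j
  · rfl
  · change _ = f 1 + f 2 + f 0
    abel
  · change _ = f 2 + f 0 + f 1
    abel

/-- Hermite interpolation at three nodes, together with the leading coefficient of the
interpolating polynomial. -/
lemma exists_hermite {a : Fin 3 → ℝ} (ha : Function.Injective a) {n : Fin 3 → ℕ}
    (hn : ∀ j, 0 < n j) (T : Fin 3 → PowerSeries ℝ) :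
    ∃ G : Polynomial ℝ, G.natDegree ≤ ∑ j, n j - 1 ∧
      G.coeff (∑ j, n j - 1) = ∑ j, coeff (n j - 1) (T j * invProd a n j) ∧
      ∀ j, ∀ m < n j, (Polynomial.taylor (a j) G).coeff m = coeff m (T j) := by
  set B : Fin 3 → Polynomial ℝ := fun j => trunc (n j) (T j * invProd a n j) with hB
  have hBdeg : ∀ j, (B j).natDegree ≤ n j - 1 := fun j => by
    obtain ⟨q, hq⟩ : ∃ q, n j = q + 1 := ⟨n j - 1, by have := hn j; omega⟩
    have := natDegree_trunc_lt (T j * invProd a n j) q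
    simp only [hB, hq]
    omega
  set R : Fin 3 → Polynomial ℝ := fun j =>
    (Polynomial.X - Polynomial.C (a (j + 1))) ^ n (j + 1)
      * (Polynomial.X - Polynomial.C (a (j + 2))) ^ n (j + 2) with hR
  have hRmonic : ∀ j, (R j).Monic := fun j =>
    ((Polynomial.monic_X_sub_C _).pow _).mul ((Polynomial.monic_X_sub_C _).pow _)
  have hRdeg : ∀ j, (R j).natDegree = n (j + 1) + n (j + 2) := fun j => by
    simp only [hR]
    rw [((Polynomial.monic_X_sub_C _).pow _).natDegree_mul ((Polynomial.monic_X_sub_C _).pow _)]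
    simp
  have hsum : ∀ j, ∑ j, n j - 1 = (n j - 1) + (n (j + 1) + n (j + 2)) := fun j => by
    rw [sum_eq_add_add n j]
    have := hn j
    omega
  refine ⟨∑ j, Polynomial.taylor (-a j) (B j) * R j, ?_, ?_, ?_⟩
  · refine Polynomial.natDegree_sum_le_of_forall_le _ _ fun j _ => ?_
    rw [hsum j, ← hRdeg j]
    refine Polynomial.natDegree_mul_le.trans ?_
    rw [Polynomial.natDegree_taylor]
    exact Nat.add_le_add_right (hBdeg j) _
  · rw [Polynomial.finsetSum_coeff]
    refine Finset.sum_congr rfl fun j _ => ?_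
    rw [hsum j, Polynomial.coeff_mul_add_eq_of_natDegree_le
      (by rw [Polynomial.natDegree_taylor]; exact hBdeg j) (hRdeg j).le,
      coeff_taylor_of_natDegree_le (hBdeg j), ← hRdeg j, (hRmonic j).coeff_natDegree, mul_one]
    simp only [hB]
    rw [coeff_trunc, if_pos (by have := hn j; omega)]
  · intro j m hm
    rw [map_sum, Polynomial.finsetSum_coeff, Finset.sum_eq_single j]
    · rw [Polynomial.taylor_mul, Polynomial.taylor_taylor, add_neg_cancel,
        Polynomial.taylor_zero, ← Polynomial.coeff_coe, Polynomial.coe_mul]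
      simp only [hB]
      rw [coeff_trunc_mul hm]
      congr 1
      have e : ∀ l, (((Polynomial.taylor (a j)) (Polynomial.X - Polynomial.C (a l)) :
          Polynomial ℝ) : PowerSeries ℝ) = C (a j - a l) + X := fun l => by
        rw [map_sub, Polynomial.taylor_X, Polynomial.taylor_C]
        simp only [Polynomial.coe_sub, Polynomial.coe_add, Polynomial.coe_X, Polynomial.coe_C,
          map_sub]
        ring
      have hd : ∀ l, l ≠ j → invLin (a j - a l) * (C (a j - a l) + X) = 1 := fun l hl =>
        invLin_mul (sub_ne_zero.mpr fun h => hl (ha h).symm)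
      simp only [hR, Polynomial.taylor_mul, Polynomial.taylor_pow, Polynomial.coe_mul,
        Polynomial.coe_pow, e, invProd]
      calc _ = T j * (invLin (a j - a (j + 1)) * (C (a j - a (j + 1)) + X)) ^ n (j + 1)
            * (invLin (a j - a (j + 2)) * (C (a j - a (j + 2)) + X)) ^ n (j + 2) := by
            simp only [mul_pow]; ring
        _ = _ := by rw [hd _ (ne_add_one j), hd _ (ne_add_two j)]; simp
    · intro i _ hij
      have hdvd : (Polynomial.X - Polynomial.C (a j)) ^ n j ∣
          Polynomial.taylor (-a i) (B i) * R i := by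
        refine Dvd.dvd.mul_left ?_ _
        rcases eq_add_one_or_add_two hij.symm with rfl | rfl
        · exact dvd_mul_right _ _
        · exact dvd_mul_left _ _
      rw [Polynomial.X_sub_C_pow_dvd_iff, ← Polynomial.taylor_apply,
        Polynomial.X_pow_dvd_iff] at hdvd
      exact hdvd m hm
    · simp

/-- The multiplicities of the nodes in the `i`-th form. -/
def mult (k : ℕ) (i j : Fin 3) : ℕ := k + if j = i then 1 else 0

lemma sum_mult (k : ℕ) (i : Fin 3) : ∑ j, mult k i j = 3 * k + 1 := by
  simp [mult, Finset.sum_add_distrib]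

/-- The Hermite–Padé coefficients for the functions `√(1 + a j x)`. -/
noncomputable def pade (a : Fin 3 → ℝ) (k : ℕ) (x : ℝ) (i j : Fin 3) : ℝ :=
  coeff (mult k i j - 1) (sqrtSeries k x (1 + a j * x) * invProd a (mult k i) j)

lemma sqrtSeries_ode (k m : ℕ) (hm : m < k) (x y : ℝ) :
    y * ((m + 1) * coeff (m + 1) (sqrtSeries k x y)) =
      (k + 1 / 2 - m) * x * coeff m (sqrtSeries k x y) := by
  rw [sqrtSeries, coeff_mk, coeff_mk, if_pos (by omega), if_pos (by omega)]
  have e : k - m = (k - (m + 1)) + 1 := by omega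
  have h := binom_succ_mul (k + 1 / 2) m
  rw [e]
  linear_combination y ^ (k - (m + 1) + 1) * x ^ (m + 1) * h

lemma prod_dvd {a : Fin 3 → ℝ} (ha : Function.Injective a) {k : ℕ} {H : Polynomial ℝ}
    (h : ∀ j, ∀ m < k, (Polynomial.taylor (a j) H).coeff m = 0) (hdeg : H.natDegree < 3 * k) :
    H = 0 := by
  by_contra hne
  have hdvd : ∏ j, (Polynomial.X - Polynomial.C (a j)) ^ k ∣ H := by
    refine Finset.prod_dvd_of_coprime ?_ fun j _ => ?_
    · intro i _ j _ hij
      exact (Polynomial.pairwise_coprime_X_sub_C ha hij).pow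
    · rw [Polynomial.X_sub_C_pow_dvd_iff, ← Polynomial.taylor_apply, Polynomial.X_pow_dvd_iff]
      exact h j
  have := Polynomial.natDegree_le_of_dvd hdvd hne
  rw [Polynomial.natDegree_prod_of_monic _ _ fun j _ => (Polynomial.monic_X_sub_C _).pow _] at this
  simp at this
  omega

lemma coeff_ode (G : Polynomial ℝ) (s t u : ℝ) (m : ℕ) :
    ((Polynomial.C s + Polynomial.C t * Polynomial.X) * Polynomial.derivative G
      - Polynomial.C u * G).coeff m =
      s * ((m + 1) * G.coeff (m + 1)) + (m * t - u) * G.coeff m := by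
  rw [add_mul, mul_assoc, Polynomial.coeff_sub, Polynomial.coeff_add, Polynomial.coeff_C_mul,
    Polynomial.coeff_C_mul, Polynomial.coeff_C_mul, Polynomial.coeff_derivative]
  cases m with
  | zero => simp; ring
  | succ m =>
    rw [Polynomial.coeff_X_mul, Polynomial.coeff_derivative]
    push_cast
    ring

/-- The matrix of Hermite–Padé coefficients is nonsingular. -/
lemma pade_nondegenerate {a : Fin 3 → ℝ} (ha : Function.Injective a) {k : ℕ} (hk : 0 < k) {x : ℝ}
    (hx : x ≠ 0) (hy : ∀ j, 1 + a j * x ≠ 0) {v : Fin 3 → ℝ}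
    (hv : ∀ i, ∑ j, pade a k x i j * v j = 0) : v = 0 := by
  set F : Fin 3 → PowerSeries ℝ := fun j => sqrtSeries k x (1 + a j * x) with hF
  have hex : ∀ i, ∃ G : Polynomial ℝ, G.natDegree < 3 * k ∧ ∀ j, ∀ m < mult k i j,
      (Polynomial.taylor (a j) G).coeff m = v j * coeff m (F j) := by
    intro i
    obtain ⟨G, h1, h2, h3⟩ := exists_hermite ha (n := mult k i)
      (fun j => by simp only [mult]; omega) (fun j => C (v j) * F j)
    rw [sum_mult, Nat.add_sub_cancel] at h1 h2
    refine ⟨G, ?_, fun j m hm => by rw [h3 j m hm, coeff_C_mul]⟩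
    have h0 : G.coeff (3 * k) = 0 := by
      rw [h2, ← hv i]
      refine Finset.sum_congr rfl fun j _ => ?_
      rw [mul_assoc, coeff_C_mul, pade, mul_comm]
    refine lt_of_le_of_ne h1 fun h => ?_
    rw [← h, Polynomial.coeff_natDegree, Polynomial.leadingCoeff_eq_zero] at h0
    rw [h0, Polynomial.natDegree_zero] at h
    omega
  choose G hGdeg hG using hex
  have hGG : ∀ i, G i = G 0 := fun i => by
    rw [← sub_eq_zero]
    refine prod_dvd ha (k := k) (fun j m hm => ?_) ?_
    · rw [map_sub, Polynomial.coeff_sub, hG i j m (by simp only [mult]; omega),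
        hG 0 j m (by simp only [mult]; omega), sub_self]
    · exact (Polynomial.natDegree_sub_le _ _).trans_lt (max_lt (hGdeg i) (hGdeg 0))
  have hGj : ∀ j, ∀ m ≤ k, (Polynomial.taylor (a j) (G 0)).coeff m = v j * coeff m (F j) :=
    fun j m hm => by
      rw [← hGG j]
      exact hG j j m (by simp only [mult, if_true]; omega)
  set u : ℝ := (k + 1 / 2) * x with hu
  set H : Polynomial ℝ := (Polynomial.C 1 + Polynomial.C x * Polynomial.X)
    * Polynomial.derivative (G 0) - Polynomial.C u * G 0 with hH
  have hH0 : H = 0 := by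
    refine prod_dvd ha (k := k) (fun j m hm => ?_) (lt_of_le_of_lt ?_ (hGdeg 0))
    · have e : Polynomial.taylor (a j) H = (Polynomial.C (1 + a j * x)
          + Polynomial.C x * Polynomial.X) * Polynomial.derivative (Polynomial.taylor (a j) (G 0))
          - Polynomial.C u * Polynomial.taylor (a j) (G 0) := by
        have hd : Polynomial.taylor (a j) (Polynomial.derivative (G 0)) =
            Polynomial.derivative (Polynomial.taylor (a j) (G 0)) := by
          simp [Polynomial.taylor_apply, Polynomial.derivative_comp]
        rw [hH, map_sub, Polynomial.taylor_mul, Polynomial.taylor_mul, hd, map_add,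
          Polynomial.taylor_mul, Polynomial.taylor_X, Polynomial.taylor_C, Polynomial.taylor_C,
          Polynomial.taylor_C]
        simp only [map_add, map_mul, map_one]
        ring
      rw [e, coeff_ode, hGj j m hm.le, hGj j (m + 1) hm]
      linear_combination v j * sqrtSeries_ode k m hm x (1 + a j * x)
    · refine Polynomial.natDegree_le_iff_coeff_eq_zero.mpr fun m hm => ?_
      rw [hH, coeff_ode, Polynomial.coeff_eq_zero_of_natDegree_lt hm,
        Polynomial.coeff_eq_zero_of_natDegree_lt (hm.trans (Nat.lt_succ_self m))]
      ring
  have hG0 : G 0 = 0 := by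
    have h := congrArg (fun p => Polynomial.coeff p (G 0).natDegree) hH0
    simp only [hH, coeff_ode, Polynomial.coeff_zero] at h
    rw [Polynomial.coeff_eq_zero_of_natDegree_lt (Nat.lt_succ_self _), mul_zero, mul_zero,
      zero_add, hu, ← sub_mul, mul_eq_zero, mul_eq_zero, Polynomial.coeff_natDegree,
      Polynomial.leadingCoeff_eq_zero] at h
    rcases h with (h | h) | h
    · exfalso
      have h2 : (2 * (G 0).natDegree : ℝ) = 2 * k + 1 := by linarith
      have h3 : 2 * (G 0).natDegree = 2 * k + 1 := by exact_mod_cast h2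
      omega
    · exact absurd h hx
    · exact h
  funext j
  have h := hGj j 0 (Nat.zero_le _)
  rw [hG0] at h
  simpa [hF, sqrtSeries, hy j] using h

/-- Rolle's theorem for three nodes with multiplicities. -/
lemma exists_zero_of_hasDerivAt {S : Set ℝ} (hS : S.OrdConnected) {g : ℕ → ℝ → ℝ}
    (hg : ∀ m, ∀ z ∈ S, HasDerivAt (g m) (g (m + 1) z) z) {a : Fin 3 → ℝ}
    (ha : Function.Injective a) (haS : ∀ j, a j ∈ S) {n : Fin 3 → ℕ} (hn : ∀ j, 0 < n j)
    (hz : ∀ j, ∀ m < n j, g m (a j) = 0) : ∃ ξ ∈ S, g (∑ j, n j - 1) ξ = 0 := by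
  classical
  have key : ∀ m, ∃ Z : Finset ℝ, (∀ z ∈ Z, z ∈ S ∧ g m z = 0) ∧ (∀ j, m < n j → a j ∈ Z) ∧
      ∑ j, min (n j) (m + 1) ≤ Z.card + m := by
    intro m
    induction m with
    | zero =>
      refine ⟨Finset.univ.image a, ?_, ?_, ?_⟩
      · intro z hz'
        obtain ⟨j, -, rfl⟩ := Finset.mem_image.mp hz'
        exact ⟨haS j, hz j 0 (hn j)⟩
      · intro j _
        exact Finset.mem_image_of_mem _ (Finset.mem_univ j)
      · rw [Finset.card_image_of_injective _ ha]
        have : ∀ j, min (n j) (0 + 1) = 1 := fun j => by have := hn j; omega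
        simp [this]
    | succ m ih =>
      obtain ⟨Z, hZ, haZ, hcard⟩ := ih
      have hroll : ∀ p : ℝ × ℝ, p.1 ∈ Z → p.2 ∈ Z → p.1 < p.2 →
          ∃ c ∈ Set.Ioo p.1 p.2, g (m + 1) c = 0 := by
        rintro ⟨s, t⟩ hs ht hst
        have hsub : Set.Icc s t ⊆ S := hS.out (hZ s hs).1 (hZ t ht).1
        exact exists_hasDerivAt_eq_zero hst
          (fun z hz' => (hg m z (hsub hz')).continuousAt.continuousWithinAt)
          ((hZ s hs).2.trans (hZ t ht).2.symm)
          fun z hz' => hg m z (hsub (Set.Ioo_subset_Icc_self hz'))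
      choose! c hc1 hc2 using hroll
      set P := (Z ×ˢ Z).filter fun p => p.1 < p.2 with hP
      set t := P.image c with ht
      have hPmem : ∀ p ∈ P, p.1 ∈ Z ∧ p.2 ∈ Z ∧ p.1 < p.2 := fun p hp => by
        simpa [hP, and_assoc] using hp
      have htcard : Z.card ≤ (t \ Z).card + 1 := by
        refine Finset.card_le_sdiff_of_interleaved fun s hs u hu hsu _ => ?_
        have hp : (s, u) ∈ P := by simp [hP, hs, hu, hsu]
        have := hc1 (s, u) hs hu hsu
        exact ⟨c (s, u), Finset.mem_image_of_mem _ hp, this.1, this.2⟩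
      set A := (Finset.univ.filter fun j => m + 1 < n j).image a with hA
      have hAmem : ∀ z ∈ A, ∃ j, m + 1 < n j ∧ a j = z := fun z hz' => by
        simpa [hA] using hz'
      refine ⟨t \ Z ∪ A, ?_, ?_, ?_⟩
      · intro z hz'
        rcases Finset.mem_union.mp hz' with h | h
        · obtain ⟨p, hp, rfl⟩ := Finset.mem_image.mp (Finset.mem_sdiff.mp h).1
          obtain ⟨h1, h2, h3⟩ := hPmem p hp
          exact ⟨hS.out (hZ _ h1).1 (hZ _ h2).1 (Set.Ioo_subset_Icc_self (hc1 p h1 h2 h3)),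
            hc2 p h1 h2 h3⟩
        · obtain ⟨j, hj, rfl⟩ := hAmem z h
          exact ⟨haS j, hz j _ hj⟩
      · intro j hj
        exact Finset.mem_union_right _ (Finset.mem_image_of_mem _ (by simpa using hj))
      · have hdisj : Disjoint (t \ Z) A := by
          rw [Finset.disjoint_left]
          intro z h h'
          obtain ⟨j, hj, rfl⟩ := hAmem z h'
          exact (Finset.mem_sdiff.mp h).2 (haZ j (by omega))
        rw [Finset.card_union_of_disjoint hdisj, hA, Finset.card_image_of_injective _ ha,
          Finset.card_filter]
        have hmin : ∀ j, min (n j) (m + 1 + 1) =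
            min (n j) (m + 1) + if m + 1 < n j then 1 else 0 := fun j => by
          split_ifs <;> omega
        simp only [hmin, Finset.sum_add_distrib]
        omega
  obtain ⟨Z, hZ, -, hcard⟩ := key (∑ j, n j - 1)
  have hle : ∀ j, n j ≤ ∑ j, n j := fun j =>
    Finset.single_le_sum (f := n) (fun _ _ => Nat.zero_le _) (Finset.mem_univ j)
  have hmin : ∀ j, min (n j) (∑ j, n j - 1 + 1) = n j := fun j => by
    have h1 := hle j
    have h2 := hn j
    omega
  simp only [hmin] at hcard
  have : 0 < Z.card := by
    have h1 := hle 0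
    have h2 := hn 0
    omega
  obtain ⟨z, hz'⟩ := Finset.card_pos.mp this
  exact ⟨z, hZ z hz'⟩

/-- The value of a Hermite–Padé form, by the mean value theorem for divided differences. -/
lemma exists_pade_form_eq {a : Fin 3 → ℝ} (ha : Function.Injective a) {k : ℕ} (hk : 0 < k)
    {x R : ℝ} (hx : 0 ≤ x) (haR : ∀ j, |a j| ≤ R) (hR : R * x < 1) (i : Fin 3) :
    ∃ ξ, |ξ| ≤ R ∧ ∑ j, pade a k x i j * √(1 + a j * x) =
      binom (k + 1 / 2) (3 * k) * x ^ (3 * k) * (1 + ξ * x) ^ ((k : ℝ) + 1 / 2 - (3 * k : ℕ)) := by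
  have hpos : ∀ z, |z| ≤ R → 0 < 1 + z * x := fun z hz => by
    have : -R * x ≤ z * x := mul_le_mul_of_nonneg_right (abs_le.mp hz).1 hx
    linarith
  obtain ⟨G, h1, h2, h3⟩ := exists_hermite ha (n := mult k i)
    (fun j => by simp only [mult]; omega)
    (fun j => PowerSeries.C (√(1 + a j * x)) * sqrtSeries k x (1 + a j * x))
  set α : ℝ := k + 1 / 2 with hα
  set g : ℕ → ℝ → ℝ := fun m z => m.factorial * binom α m * x ^ m * (1 + z * x) ^ (α - m)
    - (Polynomial.derivative^[m] G).eval z with hg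
  have hderiv : ∀ m, ∀ z ∈ Set.Icc (-R) R, HasDerivAt (g m) (g (m + 1) z) z := by
    intro m z hz
    have hz' := hpos z (abs_le.mpr hz)
    have hlin : HasDerivAt (fun z : ℝ => 1 + z * x) x z := by
      simpa using ((hasDerivAt_id z).mul_const x).const_add 1
    have h := ((hlin.rpow_const (p := α - m) (Or.inl hz'.ne')).const_mul
      (m.factorial * binom α m * x ^ m)).sub ((Polynomial.derivative^[m] G).hasDerivAt z)
    refine h.congr_deriv ?_
    simp only [hg, Function.iterate_succ_apply', Nat.factorial_succ, Nat.cast_mul, Nat.cast_succ]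
    have hb := binom_succ_mul α m
    have e : α - (m + 1 : ℝ) = α - m - 1 := by ring
    rw [e]
    linear_combination (-(m.factorial : ℝ)) * x ^ (m + 1) * (1 + z * x) ^ (α - m - 1) * hb
  have hzero : ∀ j, ∀ m < mult k i j, g m (a j) = 0 := by
    intro j m hm
    have hmk : m ≤ k := by simp only [mult] at hm; split_ifs at hm <;> omega
    have h := h3 j m hm
    have hy := hpos (a j) (haR j)
    rw [PowerSeries.coeff_C_mul, sqrtSeries, PowerSeries.coeff_mk, if_pos hmk,
      Polynomial.taylor_coeff] at h
    have hfac : (Polynomial.derivative^[m] G) = (m.factorial : ℝ) • Polynomial.hasseDeriv m G := by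
      rw [← Polynomial.factorial_smul_hasseDeriv, LinearMap.smul_apply, Nat.cast_smul_eq_nsmul]
    have hpow : (1 + a j * x) ^ (α - m) = (1 + a j * x) ^ (k - m) * √(1 + a j * x) := by
      rw [Real.sqrt_eq_rpow, ← Real.rpow_natCast, ← Real.rpow_add hy, Nat.cast_sub hmk, hα]
      congr 1
      ring
    simp only [hg]
    rw [hfac, Polynomial.eval_smul, h, hpow, smul_eq_mul]
    ring
  obtain ⟨ξ, hξ, hξ0⟩ := exists_zero_of_hasDerivAt Set.ordConnected_Icc hderiv ha
    (fun j => abs_le.mp (haR j)) (fun j => by simp only [mult]; omega) hzero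
  refine ⟨ξ, abs_le.mpr hξ, ?_⟩
  rw [sum_mult, Nat.add_sub_cancel] at h1 h2 hξ0
  have hG : Polynomial.derivative^[3 * k] G =
      Polynomial.C ((3 * k).factorial * G.coeff (3 * k)) := by
    rw [Polynomial.eq_C_of_natDegree_le_zero (p := Polynomial.derivative^[3 * k] G)
      ((Polynomial.natDegree_iterate_derivative _ _).trans (by omega)),
      Polynomial.coeff_iterate_derivative, zero_add, Nat.descFactorial_self, nsmul_eq_mul]
  simp only [hg, hG, Polynomial.eval_C] at hξ0
  have hf : ((3 * k).factorial : ℝ) ≠ 0 := by positivity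
  have e : ∑ j, pade a k x i j * √(1 + a j * x) = G.coeff (3 * k) := by
    rw [h2]
    refine Finset.sum_congr rfl fun j _ => ?_
    rw [mul_assoc, PowerSeries.coeff_C_mul, pade, mul_comm]
  rw [e]
  refine mul_left_cancel₀ hf ?_
  linear_combination -hξ0

/-- Rickert's criterion: linear forms in `1, θ 1, θ 2` with integer coefficients that are small and
linearly independent give a lower bound for simultaneous rational approximation. -/
lemma le_max_of_linear_forms {θ : Fin 3 → ℝ} (hθ : θ 0 = 1) {p l P L : ℝ} (hp : 0 < p)
    (hl : 1 ≤ l) (hP : 1 ≤ P) (hL : 1 < L) (hPL : P ≤ L)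
    (hform : ∀ k : ℕ, 0 < k → ∃ b : Fin 3 → Fin 3 → ℤ,
      (∀ v : Fin 3 → ℝ, (∀ i, ∑ j, (b i j : ℝ) * v j = 0) → v = 0) ∧
      (∀ i j, |(b i j : ℝ)| ≤ p * P ^ k) ∧ ∀ i, |∑ j, (b i j : ℝ) * θ j| ≤ l / L ^ k)
    (p₁ p₂ q : ℤ) (hq : 0 < q) :
    (8 * p * l * P)⁻¹ * (q : ℝ) ^ (-(1 + Real.log P / Real.log L)) ≤
      max |θ 1 - (p₁ : ℝ) / q| |θ 2 - (p₂ : ℝ) / q| := by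
  classical
  set δ := max |θ 1 - (p₁ : ℝ) / q| |θ 2 - (p₂ : ℝ) / q| with hδ
  set s := Real.log P / Real.log L with hs
  have hq1 : (1 : ℝ) ≤ q := by exact_mod_cast hq
  have hq0 : (0 : ℝ) < q := by linarith
  have hlogL : 0 < Real.log L := Real.log_pos hL
  have hs0 : 0 ≤ s := div_nonneg (Real.log_nonneg hP) hlogL.le
  have hs1 : s ≤ 1 := (div_le_one hlogL).mpr (Real.log_le_log (by linarith) hPL)
  have hLs : L ^ s = P := by
    rw [Real.rpow_def_of_pos (by linarith), hs, mul_div_cancel₀ _ hlogL.ne',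
      Real.exp_log (by linarith)]
  have hδ0 : 0 ≤ δ := (abs_nonneg _).trans (le_max_left _ _)
  have hex : ∃ k : ℕ, 2 * l * q ≤ L ^ k := by
    obtain ⟨k, hk⟩ := pow_unbounded_of_one_lt (2 * l * q) hL
    exact ⟨k, hk.le⟩
  have hspec := Nat.find_spec hex
  have hmin := fun m => Nat.find_min hex (m := m)
  obtain ⟨k, hk⟩ : ∃ k, Nat.find hex = k + 1 := by
    refine Nat.exists_eq_succ_of_ne_zero fun h => ?_
    rw [h, pow_zero] at hspec
    nlinarith
  rw [hk] at hspec
  have hlt : L ^ k < 2 * l * q := not_le.mp (hmin k (by omega))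
  obtain ⟨b, hb1, hb2, hb3⟩ := hform (k + 1) (Nat.succ_pos k)
  set w : Fin 3 → ℤ := ![q, p₁, p₂] with hw
  obtain ⟨i, hi⟩ : ∃ i, ∑ j, b i j * w j ≠ 0 := by
    by_contra! h
    have := congrFun (hb1 (fun j => (w j : ℝ)) fun i => by exact_mod_cast h i) 0
    simp [hw] at this
    omega
  have h1 : (1 : ℝ) ≤ |((∑ j, b i j * w j : ℤ) : ℝ)| := by
    rw [← Int.cast_abs]
    exact_mod_cast Int.one_le_abs hi
  have hsplit : ((∑ j, b i j * w j : ℤ) : ℝ) = q * ∑ j, (b i j : ℝ) * θ j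
      - q * (b i 1 * (θ 1 - (p₁ : ℝ) / q) + b i 2 * (θ 2 - (p₂ : ℝ) / q)) := by
    rw [Fin.sum_univ_three, Fin.sum_univ_three, hθ]
    simp only [hw]
    push_cast
    simp
    field_simp
    ring
  have hPk : P ^ k ≤ 2 * l * (q : ℝ) ^ s := by
    calc P ^ k = (L ^ k) ^ s := by
          rw [← hLs, ← Real.rpow_natCast, ← Real.rpow_natCast, ← Real.rpow_mul (by linarith),
            ← Real.rpow_mul (by linarith), mul_comm]
      _ ≤ (2 * l * q) ^ s := Real.rpow_le_rpow (by positivity) hlt.le hs0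
      _ = (2 * l) ^ s * (q : ℝ) ^ s := Real.mul_rpow (by positivity) hq0.le
      _ ≤ 2 * l * (q : ℝ) ^ s := by
          gcongr
          exact (Real.rpow_le_rpow_of_exponent_le (by linarith) hs1).trans_eq (Real.rpow_one _)
  have hsmall : |(q : ℝ) * ∑ j, (b i j : ℝ) * θ j| ≤ 1 / 2 := by
    rw [abs_mul, abs_of_pos hq0]
    calc (q : ℝ) * |∑ j, (b i j : ℝ) * θ j| ≤ q * (l / L ^ (k + 1)) := by gcongr; exact hb3 i
      _ ≤ 1 / 2 := by
        rw [mul_div_assoc', div_le_iff₀ (by positivity)]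
        linarith
  have hterm : |(q : ℝ) * (b i 1 * (θ 1 - (p₁ : ℝ) / q) + b i 2 * (θ 2 - (p₂ : ℝ) / q))| ≤
      q * (p * P ^ (k + 1) * δ + p * P ^ (k + 1) * δ) := by
    rw [abs_mul, abs_of_pos hq0]
    gcongr
    refine (abs_add_le _ _).trans ?_
    rw [abs_mul, abs_mul]
    have hpp : 0 ≤ p * P ^ (k + 1) := by positivity
    exact add_le_add (mul_le_mul (hb2 i 1) (le_max_left _ _) (abs_nonneg _) hpp)
      (mul_le_mul (hb2 i 2) (le_max_right _ _) (abs_nonneg _) hpp)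
  have h2 : (1 : ℝ) ≤ 1 / 2 + q * (p * P ^ (k + 1) * δ + p * P ^ (k + 1) * δ) := by
    rw [hsplit] at h1
    exact h1.trans ((abs_sub _ _).trans (add_le_add hsmall hterm))
  have h3 : q * (p * P ^ (k + 1) * δ) ≤ q * (p * (2 * l * (q : ℝ) ^ s * P) * δ) := by
    rw [pow_succ]
    gcongr
  have hqs : (q : ℝ) ^ (1 + s) = q * (q : ℝ) ^ s := by
    rw [Real.rpow_add hq0, Real.rpow_one]
  rw [Real.rpow_neg hq0.le, hqs, ← mul_inv]
  have hqs0 : 0 < (q : ℝ) ^ s := Real.rpow_pos_of_pos hq0 s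
  rw [inv_le_iff_one_le_mul₀ (by positivity)]
  linarith

lemma abs_pade_le {a : Fin 3 → ℝ} {k : ℕ} (hk : 0 < k) {x r W Y : ℝ} (hx : 0 ≤ x) (hr : 0 < r)
    (hW : 0 < W) (hsep : ∀ i j, i ≠ j → 2 * r ≤ |a i - a j|)
    (hWle : ∀ j, W ≤ r * (|a j - a (j + 1)| - r) * (|a j - a (j + 2)| - r))
    (hy : ∀ j, Y / 2 ≤ 1 + a j * x) (hY0 : 0 < Y) (hY : ∀ j, 1 + a j * x + x * r ≤ Y)
    (i j : Fin 3) : |pade a k x i j| ≤ 2 * (Y / W) ^ k := by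
  have hy0 : 0 < 1 + a j * x := lt_of_lt_of_le (by positivity) (hy j)
  set D := |a j - a (j + 1)| - r with hD
  set D' := |a j - a (j + 2)| - r with hD'
  have hrD : r ≤ D := by have := hsep j (j + 1) (ne_add_one j).symm; linarith
  have hrD' : r ≤ D' := by have := hsep j (j + 2) (ne_add_two j).symm; linarith
  have hD0 : 0 < D := hr.trans_le hrD
  have hD0' : 0 < D' := hr.trans_le hrD'
  set s := if j + 1 = i then 1 else 0 with hs
  set t := if j + 2 = i then 1 else 0 with ht
  have hm : mult k i j - 1 + s + t = k := by
    have h : ∀ i j : Fin 3, ((if j = i then 1 else 0) + (if j + 1 = i then 1 else 0)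
        + if j + 2 = i then 1 else 0) = 1 := by decide
    have := h i j
    simp only [mult]
    omega
  have h := abs_coeff_le (k := k) (m := mult k i j - 1) (n := k + s) (n' := k + t) hx hy0 hr
    (by linarith : r < |a j - a (j + 1)|) (by linarith : r < |a j - a (j + 2)|)
  rw [mul_assoc] at h
  change |pade a k x i j| * r ^ (mult k i j - 1) ≤ _ / D ^ (k + s) / D' ^ (k + t) at h
  rw [div_div, le_div_iff₀ (by positivity)] at h
  have hQ : (1 + a j * x + x * r) ^ (k + 1) / (1 + a j * x) ≤ 2 * Y ^ k := by
    rw [div_le_iff₀ hy0]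
    have h0 : 0 ≤ 1 + a j * x + x * r := by positivity
    calc _ ≤ Y ^ (k + 1) := pow_le_pow_left₀ h0 (hY j) _
      _ = 2 * Y ^ k * (Y / 2) := by ring
      _ ≤ _ := by gcongr; exact hy j
  rw [div_pow, mul_div_assoc', le_div_iff₀ (by positivity)]
  calc |pade a k x i j| * W ^ k ≤ |pade a k x i j| * (r * D * D') ^ k := by
        gcongr; exact hWle j
    _ = |pade a k x i j| * r ^ (mult k i j - 1) * ((D ^ k * r ^ s) * (D' ^ k * r ^ t)) := by
        have hrk : r ^ k = r ^ (mult k i j - 1) * r ^ s * r ^ t := by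
          rw [← pow_add, ← pow_add, hm]
        rw [mul_pow, mul_pow, hrk]
        ring
    _ ≤ |pade a k x i j| * r ^ (mult k i j - 1) * (D ^ (k + s) * D' ^ (k + t)) := by
        rw [pow_add, pow_add]
        gcongr
    _ ≤ 2 * Y ^ k := h.trans hQ

lemma exists_int_eq_pade {a : Fin 3 → ℝ} (ha : Function.Injective a) {k : ℕ} (hk : 0 < k)
    {E N : ℝ} (hN : N ≠ 0)
    (hE : ∀ j, ∃ g : ℤ, E = 4 * ((a j - a (j + 1)) * (a j - a (j + 2))) * g)
    (hu : ∀ j, ∃ u : ℤ, 4 * (N + a j) = (a j - a (j + 1)) * u)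
    (hu' : ∀ j, ∃ u : ℤ, 4 * (N + a j) = (a j - a (j + 2)) * u) (i j : Fin 3) :
    ∃ b : ℤ, (b : ℝ) = (E * N) ^ k * pade a k (1 / N) i j := by
  have hm : mult k i j - 1 + (if j + 1 = i then 1 else 0) + (if j + 2 = i then 1 else 0) = k := by
    have h : ∀ i j : Fin 3, ((if j = i then 1 else 0) + (if j + 1 = i then 1 else 0)
        + if j + 2 = i then 1 else 0) = 1 := by decide
    have := h i j
    simp only [mult]
    omega
  have hne : ∀ l, l ≠ j → a j - a l ≠ 0 := fun l hl => sub_ne_zero.mpr fun h => hl (ha h).symm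
  obtain ⟨b, hb⟩ := pow_mul_coeff_mem_int (hne _ (ne_add_one j)) (hne _ (ne_add_two j)) hm
    (mul_one_div_cancel hN) (by field_simp : N * (1 + a j * (1 / N)) = N + a j) (hE j) (hu j)
    (hu' j)
  refine ⟨b, ?_⟩
  rw [pade, invProd, ← mul_assoc]
  exact hb

/-- The nodes of the Hermite–Padé construction. -/
def nodes (ε A : ℝ) : Fin 3 → ℝ := ![0, -ε * A, ε]

lemma abs_nodes_sub {ε A : ℝ} (hA : 0 ≤ A) :
    |nodes ε A 0 - nodes ε A 1| = |ε| * A ∧ |nodes ε A 1 - nodes ε A 2| = |ε| * (A + 1) ∧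
      |nodes ε A 2 - nodes ε A 0| = |ε| := by
  refine ⟨?_, ?_, ?_⟩
  · simp [nodes, abs_mul, abs_of_nonneg hA]
  · have : nodes ε A 1 - nodes ε A 2 = -(ε * (A + 1)) := by simp [nodes]; ring
    rw [this, abs_neg, abs_mul, abs_of_nonneg (by linarith : 0 ≤ A + 1)]
  · simp [nodes]

lemma nodes_sep {ε A : ℝ} (hA : 1 ≤ A) (i j : Fin 3) (hij : i ≠ j) :
    |ε| ≤ |nodes ε A i - nodes ε A j| := by
  obtain ⟨h1, h2, h3⟩ := abs_nodes_sub (ε := ε) (by linarith : 0 ≤ A)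
  have h0 := abs_nonneg ε
  have h1' : |ε| ≤ |nodes ε A 0 - nodes ε A 1| := by rw [h1]; nlinarith
  have h2' : |ε| ≤ |nodes ε A 1 - nodes ε A 2| := by rw [h2]; nlinarith
  have h3' : |ε| ≤ |nodes ε A 2 - nodes ε A 0| := h3.ge
  have h1'' := h1'
  have h2'' := h2'
  have h3'' := h3'
  rw [abs_sub_comm] at h1'' h2'' h3''
  fin_cases i <;> fin_cases j <;> first | exact absurd rfl hij | assumption

lemma le_nodes_prod {ε A : ℝ} (hA : 1 ≤ A) (j : Fin 3) :
    |ε| ^ 3 * (2 * A - 1) / 8 ≤ |ε| / 2 * (|nodes ε A j - nodes ε A (j + 1)| - |ε| / 2)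
      * (|nodes ε A j - nodes ε A (j + 2)| - |ε| / 2) := by
  obtain ⟨h1, h2, h3⟩ := abs_nodes_sub (ε := ε) (by linarith : 0 ≤ A)
  have h3ε : 0 ≤ |ε| ^ 3 := by positivity
  fin_cases j
  · change _ ≤ |ε| / 2 * (|nodes ε A 0 - nodes ε A 1| - |ε| / 2)
      * (|nodes ε A 0 - nodes ε A 2| - |ε| / 2)
    rw [abs_sub_comm _ (nodes ε A 2), h1, h3]
    apply le_of_eq
    ring
  · change _ ≤ |ε| / 2 * (|nodes ε A 1 - nodes ε A 2| - |ε| / 2)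
      * (|nodes ε A 1 - nodes ε A 0| - |ε| / 2)
    rw [abs_sub_comm _ (nodes ε A 0), h1, h2]
    have : |ε| / 2 * (|ε| * (A + 1) - |ε| / 2) * (|ε| * A - |ε| / 2) =
      |ε| ^ 3 * ((2 * A + 1) * (2 * A - 1) / 8) := by ring
    rw [this, mul_div_assoc]
    gcongr
    nlinarith
  · change _ ≤ |ε| / 2 * (|nodes ε A 2 - nodes ε A 0| - |ε| / 2)
      * (|nodes ε A 2 - nodes ε A 1| - |ε| / 2)
    rw [abs_sub_comm _ (nodes ε A 1), h3, h2]
    have : |ε| / 2 * (|ε| - |ε| / 2) * (|ε| * (A + 1) - |ε| / 2) =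
      |ε| ^ 3 * ((2 * A + 1) / 8) := by ring
    rw [this, mul_div_assoc]
    gcongr
    linarith

/-- The arithmetic of the nodes which makes the scaled Hermite–Padé coefficients integers. -/
lemma nodes_arith {ε A K : ℤ} (hε : ε ∣ 2) {N : ℝ}
    (hN : N = ((A : ℝ) ^ 2 + A) * K / 2 + ε * A) (j : Fin 3) :
    (∃ g : ℤ, (4 * ε ^ 2 * A * (A + 1) : ℝ) = 4 * ((nodes ε A j - nodes ε A (j + 1))
      * (nodes ε A j - nodes ε A (j + 2))) * g) ∧
    (∃ u : ℤ, 4 * (N + nodes ε A j) = (nodes ε A j - nodes ε A (j + 1)) * u) ∧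
    ∃ u : ℤ, 4 * (N + nodes ε A j) = (nodes ε A j - nodes ε A (j + 2)) * u := by
  obtain ⟨e, he⟩ := hε
  have he' : (2 : ℝ) = ε * e := by exact_mod_cast he
  have n0 : nodes ε A 0 = 0 := rfl
  have n1 : nodes ε A 1 = -ε * A := rfl
  have n2 : nodes ε A 2 = ε := rfl
  have h4 : 4 * N = ε * e * A * (A + 1) * K + 4 * ε * A := by rw [hN, ← he']; ring
  fin_cases j
  · change (∃ g : ℤ, (4 * ε ^ 2 * A * (A + 1) : ℝ) = 4 * ((nodes ε A 0 - nodes ε A 1)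
      * (nodes ε A 0 - nodes ε A 2)) * g) ∧
      (∃ u : ℤ, 4 * (N + nodes ε A 0) = (nodes ε A 0 - nodes ε A 1) * u) ∧
      ∃ u : ℤ, 4 * (N + nodes ε A 0) = (nodes ε A 0 - nodes ε A 2) * u
    rw [n0, n1, n2]
    refine ⟨⟨-(A + 1), ?_⟩, ⟨e * (A + 1) * K + 4, ?_⟩, ⟨-(e * A * (A + 1) * K + 4 * A), ?_⟩⟩ <;>
      push_cast <;> first | linear_combination h4 | ring
  · change (∃ g : ℤ, (4 * ε ^ 2 * A * (A + 1) : ℝ) = 4 * ((nodes ε A 1 - nodes ε A 2)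
      * (nodes ε A 1 - nodes ε A 0)) * g) ∧
      (∃ u : ℤ, 4 * (N + nodes ε A 1) = (nodes ε A 1 - nodes ε A 2) * u) ∧
      ∃ u : ℤ, 4 * (N + nodes ε A 1) = (nodes ε A 1 - nodes ε A 0) * u
    rw [n0, n1, n2]
    refine ⟨⟨1, ?_⟩, ⟨-(e * A * K), ?_⟩, ⟨-(e * (A + 1) * K), ?_⟩⟩ <;>
      push_cast <;> first | linear_combination h4 | ring
  · change (∃ g : ℤ, (4 * ε ^ 2 * A * (A + 1) : ℝ) = 4 * ((nodes ε A 2 - nodes ε A 0)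
      * (nodes ε A 2 - nodes ε A 1)) * g) ∧
      (∃ u : ℤ, 4 * (N + nodes ε A 2) = (nodes ε A 2 - nodes ε A 0) * u) ∧
      ∃ u : ℤ, 4 * (N + nodes ε A 2) = (nodes ε A 2 - nodes ε A 1) * u
    rw [n0, n1, n2]
    refine ⟨⟨A, ?_⟩, ⟨e * A * (A + 1) * K + 4 * (A + 1), ?_⟩, ⟨e * A * K + 4, ?_⟩⟩ <;>
      push_cast <;> first | linear_combination h4 | ring

lemma abs_pade_form_le {a : Fin 3 → ℝ} (ha : Function.Injective a) {k : ℕ} (hk : 0 < k)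
    {x R : ℝ} (hx : 0 ≤ x) (haR : ∀ j, |a j| ≤ R) (hR : R * x ≤ 1 / 100) (i : Fin 3) :
    |∑ j, pade a k x i j * √(1 + a j * x)| ≤ 2 * (4 / 27 * x ^ 3 * (100 / 99) ^ 2) ^ k := by
  obtain ⟨ξ, hξ, h⟩ := exists_pade_form_eq ha hk hx haR (by linarith) i
  have h1 : |ξ * x| ≤ 1 / 100 := by
    rw [abs_mul, abs_of_nonneg hx]
    exact (mul_le_mul_of_nonneg_right hξ hx).trans hR
  obtain ⟨h2, h3⟩ := abs_le.mp h1
  set u := 1 + ξ * x with hu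
  have hu0 : 99 / 100 ≤ u := by linarith
  have hupos : 0 < u := by linarith
  have hpow : u ^ ((k : ℝ) + 1 / 2 - (3 * k : ℕ)) ≤ 2 * ((100 / 99) ^ 2) ^ k := by
    have e : (k : ℝ) + 1 / 2 - (3 * k : ℕ) = 1 / 2 - (2 * k : ℕ) := by push_cast; ring
    rw [e, Real.rpow_sub hupos, Real.rpow_natCast, ← Real.sqrt_eq_rpow, div_eq_mul_inv,
      ← inv_pow, pow_mul]
    gcongr
    · exact Real.sqrt_le_iff.mpr ⟨by norm_num, by linarith⟩
    · rw [inv_le_comm₀ hupos (by norm_num)]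
      linarith
  rw [h, abs_mul, abs_mul, abs_of_nonneg (by positivity : 0 ≤ x ^ (3 * k)),
    abs_of_nonneg (Real.rpow_nonneg hupos.le _)]
  calc _ ≤ (4 / 27) ^ k * x ^ (3 * k) * (2 * ((100 / 99) ^ 2) ^ k) := by
        gcongr
        exact abs_binom_three_mul_le k
    _ = _ := by rw [mul_pow, mul_pow, pow_mul]; ring

/-- The scaled Hermite–Padé coefficients are integers giving small independent linear forms. -/
lemma exists_linear_forms {ε A K : ℤ} (hε : ε ∣ 2) {N : ℝ}
    (hN : N = ((A : ℝ) ^ 2 + A) * K / 2 + ε * A) (hA : 2 ≤ A)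
    (hAε : 32.32 * (A : ℝ) ≤ 20 * |(ε : ℝ)| * (2 * A - 1)) (hNA : 200 * |(ε : ℝ)| * A ≤ N)
    {k : ℕ} (hk : 0 < k) :
    ∃ b : Fin 3 → Fin 3 → ℤ,
      (∀ v : Fin 3 → ℝ, (∀ i, ∑ j, (b i j : ℝ) * v j = 0) → v = 0) ∧
      (∀ i j, |(b i j : ℝ)| ≤ 2 * (20 * ((A : ℝ) + 1) * N) ^ k) ∧
      ∀ i, |∑ j, (b i j : ℝ) * √(1 + nodes ε A j * (1 / N))| ≤
        2 / (1.338 * N ^ 2 / (|(ε : ℝ)| ^ 3 * A * (A + 1))) ^ k := by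
  have hε0 : ε ≠ 0 := by rintro rfl; simp at hε
  have hA' : (2 : ℝ) ≤ A := by exact_mod_cast hA
  have he1 : 1 ≤ |(ε : ℝ)| := by exact_mod_cast Int.one_le_abs hε0
  have hesq : (ε : ℝ) ^ 2 = |(ε : ℝ)| ^ 2 := (sq_abs _).symm
  have hEj := nodes_arith hε hN
  have hsep := nodes_sep (ε := ε) (by linarith : (1 : ℝ) ≤ A)
  have hWle := le_nodes_prod (ε := ε) (by linarith : (1 : ℝ) ≤ A)
  set a := nodes ε A with hadef
  set e := |(ε : ℝ)| with hedef
  have hN0 : 0 < N := by nlinarith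
  have ha : Function.Injective a := fun i j hij => by
    by_contra h
    have := hsep i j h
    rw [hij, sub_self, abs_zero] at this
    linarith
  have haR : ∀ j, |a j| ≤ e * A := by
    have h1 : |a 0| ≤ e * A := by
      change |(0 : ℝ)| ≤ _
      rw [abs_zero]
      positivity
    have h2 : |a 1| ≤ e * A := by
      change |-(ε : ℝ) * A| ≤ _
      rw [abs_mul, abs_neg, abs_of_nonneg (by linarith : (0 : ℝ) ≤ A)]
    have h3 : |a 2| ≤ e * A := by
      change e ≤ _
      nlinarith
    intro j
    fin_cases j <;> assumption
  have hx : 0 ≤ 1 / N := by positivity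
  have hRx : e * A * (1 / N) ≤ 1 / 200 := by
    rw [mul_one_div, div_le_iff₀ hN0]
    linarith
  have hrx : 1 / N * (e / 2) ≤ 1 / 800 := by
    rw [one_div_mul_eq_div, div_le_iff₀ hN0]
    nlinarith
  have hax : ∀ j, |a j * (1 / N)| ≤ 1 / 200 := fun j => by
    rw [abs_mul, abs_of_nonneg hx]
    exact (mul_le_mul_of_nonneg_right (haR j) hx).trans hRx
  have hE0 : 0 < 4 * (ε : ℝ) ^ 2 * A * (A + 1) := by rw [hesq]; positivity
  have hscale : 0 < 4 * (ε : ℝ) ^ 2 * A * (A + 1) * N := by positivity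
  choose b hb using exists_int_eq_pade ha hk hN0.ne' (fun j => (hEj j).1) (fun j => (hEj j).2.1)
    (fun j => (hEj j).2.2)
  have hsum : ∀ i, ∀ v : Fin 3 → ℝ, ∑ j, (b i j : ℝ) * v j =
      (4 * (ε : ℝ) ^ 2 * A * (A + 1) * N) ^ k * ∑ j, pade a k (1 / N) i j * v j := fun i v => by
    simp only [hb, Finset.mul_sum, mul_assoc]
  refine ⟨b, fun v hv => ?_, fun i j => ?_, fun i => ?_⟩
  · refine pade_nondegenerate ha hk (one_div_ne_zero hN0.ne')
      (fun j => (by linarith [(abs_le.mp (hax j)).1] : 0 < 1 + a j * (1 / N)).ne') fun i => ?_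
    have := hv i
    rw [hsum] at this
    exact (mul_eq_zero.mp this).resolve_left (pow_ne_zero _ hscale.ne')
  · have h := abs_pade_le hk hx (r := e / 2) (W := e ^ 3 * (2 * A - 1) / 8) (Y := 101 / 100)
      (by positivity) (div_pos (mul_pos (by positivity) (by linarith)) (by norm_num))
      (fun i j hij => by linarith [hsep i j hij]) hWle
      (fun j => by linarith [(abs_le.mp (hax j)).1]) (by norm_num)
      (fun j => by linarith [(abs_le.mp (hax j)).2]) i j
    have hW0 : 0 < e ^ 3 * (2 * A - 1) / 8 :=
      div_pos (mul_pos (by positivity) (by linarith)) (by norm_num)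
    rw [hb, abs_mul, abs_of_nonneg (by positivity)]
    calc _ ≤ (4 * (ε : ℝ) ^ 2 * A * (A + 1) * N) ^ k
          * (2 * (101 / 100 / (e ^ 3 * (2 * A - 1) / 8)) ^ k) := by gcongr
      _ = 2 * (4 * (ε : ℝ) ^ 2 * A * (A + 1) * N * (101 / 100 / (e ^ 3 * (2 * A - 1) / 8))) ^ k := by
        rw [mul_pow _ (101 / 100 / _ : ℝ)]; ring
      _ ≤ _ := by
        refine mul_le_mul_of_nonneg_left (pow_le_pow_left₀ (by positivity) ?_ k) two_pos.le
        rw [hesq, mul_div_assoc', div_le_iff₀ hW0]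
        have h2 : 0 ≤ e ^ 2 * (A + 1) * N / 8 := by positivity
        nlinarith [mul_le_mul_of_nonneg_right hAε h2]
  · have h := abs_pade_form_le ha hk hx haR (by linarith) i
    rw [hsum, abs_mul, abs_of_nonneg (by positivity), div_eq_mul_inv 2, ← inv_pow]
    calc _ ≤ (4 * (ε : ℝ) ^ 2 * A * (A + 1) * N) ^ k
          * (2 * (4 / 27 * (1 / N) ^ 3 * (100 / 99) ^ 2) ^ k) := by gcongr
      _ = 2 * (4 * (ε : ℝ) ^ 2 * A * (A + 1) * N
          * (4 / 27 * (1 / N) ^ 3 * (100 / 99) ^ 2)) ^ k := by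
        rw [mul_pow _ (4 / 27 * (1 / N) ^ 3 * (100 / 99) ^ 2)]; ring
      _ ≤ _ := by
        gcongr
        have h1 : 4 * (ε : ℝ) ^ 2 * A * (A + 1) * N * (4 / 27 * (1 / N) ^ 3 * (100 / 99) ^ 2) =
            (16 / 27 * (100 / 99) ^ 2) * (e ^ 2 * A * (A + 1) / N ^ 2) := by
          rw [hesq]; field_simp; norm_num
        have h2 : (1.338 * N ^ 2 / (e ^ 3 * A * (A + 1)))⁻¹ =
            (e / 1.338) * (e ^ 2 * A * (A + 1) / N ^ 2) := by
          field_simp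
        rw [h1, h2]
        gcongr
        norm_num
        linarith

/-- The size conditions on `N` implied by the lower bound for `K`. -/
lemma size_bounds {ε A K N : ℝ} (hA : 0 < A) (hs : 16 ≤ |ε| ^ 2 * (A + 1) ^ 2) (hε : 0 < |ε|)
    (hK : 30.03 * |ε| ^ 3 * (A + 1) ≤ K) (hN : N = (A ^ 2 + A) * K / 2 + ε * A) :
    200 * |ε| * A ≤ N ∧ 20 * (A + 1) * N < 1.338 * N ^ 2 / (|ε| ^ 3 * A * (A + 1)) := by
  have h1 : |ε| * A * (15.015 * (|ε| ^ 2 * (A + 1) ^ 2) - 1) ≤ N := by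
    have h2 : -(|ε| * A) ≤ ε * A := by nlinarith [neg_abs_le ε]
    have h3 := mul_le_mul_of_nonneg_left hK (by positivity : 0 ≤ (A ^ 2 + A) / 2)
    rw [hN]
    nlinarith
  have h0 : 0 < |ε| * A := by positivity
  set s := |ε| ^ 2 * (A + 1) ^ 2 with hsdef
  have hN1 : 200 * |ε| * A ≤ N := by nlinarith
  have hN0 : 0 < N := by nlinarith
  refine ⟨hN1, ?_⟩
  rw [lt_div_iff₀ (by positivity)]
  have h4 : 20 * (|ε| * A * s) < 1.338 * N := by nlinarith
  calc _ = 20 * (|ε| * A * s) * N := by rw [hsdef]; ring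
    _ < 1.338 * N * N := by gcongr
    _ = _ := by ring

end HermitePade

theorem stmt_5 (ε A K : ℤ) (N θ₁ θ₂ lam : ℝ)
    (hε : ε = -2 ∨ ε = -1 ∨ ε = 1 ∨ ε = 2)
    (hA : 0 < A) (hK : 0 < K)
    (hKge : (K : ℝ) ≥ 30.03 * |(ε : ℝ)| ^ 3 * ((A : ℝ) + 1))
    (hcase : A ≥ 3 ∨ (A = 2 ∧ |ε| = 2))
    (hN : N = ((A : ℝ) ^ 2 + A) * K / 2 + ε * A)
    (hθ₁ : θ₁ = Real.sqrt (1 - (ε : ℝ) * A / N))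
    (hθ₂ : θ₂ = Real.sqrt (1 + (ε : ℝ) / N))
    (hlam : lam = 1 + Real.log (20 * ((A : ℝ) + 1) * N) /
      Real.log (1.338 * N ^ 2 / (|(ε : ℝ)| ^ 3 * A * (A + 1)))) :
    lam < 2 ∧
    ∀ p₁ p₂ q : ℤ, 0 < q →
      max |θ₁ - (p₁ : ℝ) / q| |θ₂ - (p₂ : ℝ) / q| >
        (2.838e28 * ((A : ℝ) + 1) * N)⁻¹ * (q : ℝ) ^ (-lam) := by
  have hdvd : ε ∣ 2 := by rcases hε with rfl | rfl | rfl | rfl <;> decide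
  have hε0 : ε ≠ 0 := by rintro rfl; simp at hdvd
  have hA2 : 2 ≤ A := by rcases hcase with h | h <;> omega
  have hA2' : (2 : ℝ) ≤ A := by exact_mod_cast hA2
  have he1 : 1 ≤ |(ε : ℝ)| := by exact_mod_cast Int.one_le_abs hε0
  have hs : 16 ≤ |(ε : ℝ)| ^ 2 * ((A : ℝ) + 1) ^ 2 := by
    rcases hcase with h | ⟨rfl, h⟩
    · have h3 : (3 : ℝ) ≤ A := by exact_mod_cast h
      nlinarith [mul_le_mul he1 (by linarith : (4 : ℝ) ≤ A + 1) (by norm_num) (abs_nonneg _)]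
    · have h2 : |(ε : ℝ)| = 2 := by exact_mod_cast h
      rw [h2]
      norm_num
  have hAε : 32.32 * (A : ℝ) ≤ 20 * |(ε : ℝ)| * (2 * A - 1) := by
    rcases hcase with h | ⟨rfl, h⟩
    · have h3 : (3 : ℝ) ≤ A := by exact_mod_cast h
      nlinarith
    · have h2 : |(ε : ℝ)| = 2 := by exact_mod_cast h
      rw [h2]
      norm_num
  obtain ⟨hNA, hPL⟩ := HermitePade.size_bounds (by linarith) hs (by linarith) hKge hN
  have hN1 : 1 ≤ N := by nlinarith
  have hP : 1 < 20 * ((A : ℝ) + 1) * N := by nlinarith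
  have hL := hP.trans hPL
  refine ⟨?_, fun p₁ p₂ q hq => ?_⟩
  · have := (div_lt_one (Real.log_pos hL)).mpr (Real.log_lt_log (by linarith) hPL)
    linarith
  have hnodes := HermitePade.le_max_of_linear_forms
    (θ := fun j => √(1 + HermitePade.nodes ε A j * (1 / N))) (by simp [HermitePade.nodes])
    two_pos one_le_two hP.le hL hPL.le
    (fun k hk => HermitePade.exists_linear_forms hdvd hN hA2 hAε hNA hk) p₁ p₂ q hq
  have e₁ : √(1 + HermitePade.nodes ε A 1 * (1 / N)) = θ₁ := by
    rw [hθ₁]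
    congr 1
    simp only [HermitePade.nodes, Matrix.cons_val_one, Matrix.cons_val_zero]
    ring
  have e₂ : √(1 + HermitePade.nodes ε A 2 * (1 / N)) = θ₂ := by
    rw [hθ₂]
    congr 1
    simp [HermitePade.nodes]
    ring
  simp only [e₁, e₂, ← hlam] at hnodes
  refine lt_of_lt_of_le ?_ hnodes
  have hq' : (0 : ℝ) < q := by exact_mod_cast hq
  gcongr ?_ * _
  apply inv_strictAnti₀ (by positivity)
  nlinarith [mul_pos (by linarith : (0 : ℝ) < A + 1) (by linarith : 0 < N)]
end

section
/- With a = K, b = A²K − 4A, c = (A+1)²K − 4(A+1), r = AK − 2, s = (A+1)K − 2, α = (s + √(ac))/2, β = (r + √(ab))/2, and A, K positive integers with either A ≥ 3 and (K = 3 or K ≥ 5), or A = 2 and K ≥ 6, one has α − β > K = s − r. -/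
/-- On `[2, ∞)` the function `x ↦ √(x ^ 2 - 4)` grows with slope greater than `1`. -/
theorem sqrt_sq_sub_four_add_lt {x k : ℝ} (hx : 2 ≤ x) (hk : 0 < k) :
    Real.sqrt (x ^ 2 - 4) + k < Real.sqrt ((x + k) ^ 2 - 4) := by
  have hlt : Real.sqrt (x ^ 2 - 4) < x := by
    rw [Real.sqrt_lt' (by linarith)]
    linarith
  have hsq : Real.sqrt (x ^ 2 - 4) ^ 2 = x ^ 2 - 4 := Real.sq_sqrt (by nlinarith)
  apply Real.lt_sqrt_of_sq_lt
  nlinarith [mul_lt_mul_of_pos_left hlt hk]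

theorem stmt_6 (A K : ℤ) (hA : 0 < A) (hK : 0 < K)
    (hcase : (A ≥ 3 ∧ (K = 3 ∨ K ≥ 5)) ∨ (A = 2 ∧ K ≥ 6))
    (a b c r s α β : ℝ)
    (ha : a = (K : ℝ)) (hb : b = (A : ℝ) ^ 2 * K - 4 * A)
    (hc : c = ((A : ℝ) + 1) ^ 2 * K - 4 * ((A : ℝ) + 1))
    (hr : r = (A : ℝ) * K - 2) (hs : s = ((A : ℝ) + 1) * K - 2)
    (hα : α = (s + Real.sqrt (a * c)) / 2)
    (hβ : β = (r + Real.sqrt (a * b)) / 2) :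
    α - β > (K : ℝ) ∧ (K : ℝ) = s - r := by
  have hAK : (4 : ℤ) ≤ A * K := by
    rcases hcase with ⟨h, h' | h'⟩ | ⟨h, h'⟩ <;> nlinarith
  have hAKr : (4 : ℝ) ≤ (A : ℝ) * K := by exact_mod_cast hAK
  have hKr : (0 : ℝ) < K := by exact_mod_cast hK
  have hac : a * c = s ^ 2 - 4 := by rw [ha, hc, hs]; ring
  have hab : a * b = r ^ 2 - 4 := by rw [ha, hb, hr]; ring
  have hsr : s = r + K := by rw [hs, hr]; ring
  have hr2 : 2 ≤ r := by linarith
  have hlt := sqrt_sq_sub_four_add_lt hr2 hKr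
  rw [hac] at hα
  rw [hab] at hβ
  rw [← hsr] at hlt
  constructor <;> linarith
end

section
/- With a = K, b = A²K − 4A, c = (A+1)²K − 4(A+1), r = AK − 2, s = (A+1)K − 2, α = (s + √(ac))/2, β = (r + √(ab))/2, and A, K positive integers with either A ≥ 3 and (K = 3 or K ≥ 5), or A = 2 and K ≥ 6, one has 1/(A+1) < √(a/c) < log(α/β) < √(a/b) < 1/(A−1). -/
/-- The mean value theorem for `cosh`, with `sinh` bounded at the endpoints. -/
lemma cosh_sub_cosh_bounds {x y : ℝ} (hxy : y < x) :
    (x - y) * Real.sinh y < Real.cosh x - Real.cosh y ∧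
      Real.cosh x - Real.cosh y < (x - y) * Real.sinh x := by
  obtain ⟨ξ, ⟨h₁, h₂⟩, h⟩ := exists_hasDerivAt_eq_slope Real.cosh Real.sinh hxy
    Real.continuous_cosh.continuousOn fun z _ => Real.hasDerivAt_cosh z
  have hpos : 0 < x - y := sub_pos.mpr hxy
  rw [eq_div_iff hpos.ne', mul_comm] at h
  rw [← h]
  exact ⟨mul_lt_mul_of_pos_left (Real.sinh_lt_sinh.mpr h₁) hpos,
    mul_lt_mul_of_pos_left (Real.sinh_lt_sinh.mpr h₂) hpos⟩

lemma cosh_sinh_log_quadratic_root {t : ℝ} (ht : 2 < t) :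
    Real.cosh (Real.log ((t + √(t ^ 2 - 4)) / 2)) = t / 2 ∧
      Real.sinh (Real.log ((t + √(t ^ 2 - 4)) / 2)) = √(t ^ 2 - 4) / 2 := by
  have hsq : √(t ^ 2 - 4) ^ 2 = t ^ 2 - 4 := Real.sq_sqrt (by nlinarith)
  have hpos : 0 < (t + √(t ^ 2 - 4)) / 2 := by positivity
  have hinv : ((t + √(t ^ 2 - 4)) / 2)⁻¹ = (t - √(t ^ 2 - 4)) / 2 :=
    inv_eq_of_mul_eq_one_right (by linear_combination -hsq / 4)
  rw [Real.cosh_log hpos, Real.sinh_log hpos, hinv]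
  constructor <;> ring

lemma log_quadratic_root_div_bounds {t u : ℝ} (ht : 2 < t) (htu : t < u) :
    (u - t) / √(u ^ 2 - 4) <
        Real.log (((u + √(u ^ 2 - 4)) / 2) / ((t + √(t ^ 2 - 4)) / 2)) ∧
      Real.log (((u + √(u ^ 2 - 4)) / 2) / ((t + √(t ^ 2 - 4)) / 2)) <
        (u - t) / √(t ^ 2 - 4) := by
  have hdt : 0 < √(t ^ 2 - 4) := Real.sqrt_pos.mpr (by nlinarith)
  have hdtu : √(t ^ 2 - 4) < √(u ^ 2 - 4) := Real.sqrt_lt_sqrt (by nlinarith) (by nlinarith)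
  have hdu : 0 < √(u ^ 2 - 4) := hdt.trans hdtu
  have hlog := Real.log_lt_log (x := (t + √(t ^ 2 - 4)) / 2) (y := (u + √(u ^ 2 - 4)) / 2)
    (by positivity) (by linarith)
  have hbounds := cosh_sub_cosh_bounds hlog
  obtain ⟨hct, hst⟩ := cosh_sinh_log_quadratic_root ht
  obtain ⟨hcu, hsu⟩ := cosh_sinh_log_quadratic_root (ht.trans htu)
  rw [hct, hst, hcu, hsu] at hbounds
  rw [Real.log_div (by linarith) (by linarith), div_lt_iff₀ hdu, lt_div_iff₀ hdt]
  constructor <;> linarith [hbounds.1, hbounds.2]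

lemma sqrt_div_eq_div_sqrt_mul {a b : ℝ} (ha : 0 < a) : √(a / b) = a / √(a * b) := by
  rw [Real.sqrt_div ha.le, Real.sqrt_mul ha.le, ← div_div, Real.div_sqrt]

theorem stmt_7 (A K : ℤ) (hA : 0 < A) (hK : 0 < K)
    (hcase : (A ≥ 3 ∧ (K = 3 ∨ K ≥ 5)) ∨ (A = 2 ∧ K ≥ 6))
    (a b c r s α β : ℝ)
    (ha : a = (K : ℝ)) (hb : b = (A : ℝ) ^ 2 * K - 4 * A)
    (hc : c = ((A : ℝ) + 1) ^ 2 * K - 4 * ((A : ℝ) + 1))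
    (hr : r = (A : ℝ) * K - 2) (hs : s = ((A : ℝ) + 1) * K - 2)
    (hα : α = (s + Real.sqrt (a * c)) / 2)
    (hβ : β = (r + Real.sqrt (a * b)) / 2) :
    1 / ((A : ℝ) + 1) < Real.sqrt (a / c) ∧
    Real.sqrt (a / c) < Real.log (α / β) ∧
    Real.log (α / β) < Real.sqrt (a / b) ∧
    Real.sqrt (a / b) < 1 / ((A : ℝ) - 1) := by
  have hA2 : (2 : ℝ) ≤ A := by exact_mod_cast (by omega : (2 : ℤ) ≤ A)
  have hK3 : (3 : ℝ) ≤ K := by exact_mod_cast (by omega : (3 : ℤ) ≤ K)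
  have hAK : (6 : ℝ) ≤ A * K := by nlinarith
  have ha0 : 0 < a := by linarith
  have hb0 : 0 < b := by rw [hb]; nlinarith
  have hc0 : 0 < c := by rw [hc]; nlinarith
  have hab : a * b = r ^ 2 - 4 := by rw [ha, hb, hr]; ring
  have hac : a * c = s ^ 2 - 4 := by rw [ha, hc, hs]; ring
  have hsr : s - r = a := by rw [ha, hs, hr]; ring
  have hlog := log_quadratic_root_div_bounds (t := r) (u := s) (by linarith) (by linarith)
  rw [← hab, ← hac, ← hα, ← hβ, hsr, ← sqrt_div_eq_div_sqrt_mul ha0,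
    ← sqrt_div_eq_div_sqrt_mul ha0] at hlog
  refine ⟨?_, hlog.1, hlog.2, ?_⟩
  · rw [Real.lt_sqrt (by positivity), div_pow, div_lt_div_iff₀ (by positivity) hc0, ha, hc]
    nlinarith
  · have hA1 : (0 : ℝ) < A - 1 := by linarith
    rw [Real.sqrt_lt' (by positivity), div_pow, div_lt_div_iff₀ hb0 (by positivity), ha, hb]
    nlinarith
end

section
/- Let A₀ ≥ 2, K₀ ≥ 3, and ρ ≥ 14 be integers. With a = K, b = A²K − 4A, c = (A+1)²K − 4(A+1), r = AK − 2, β = (r + √(ab))/2: if A ≥ A₀, K ≥ K₀, and AK ≥ 2ρ + 4, then bc²(c − a) < 0.992⁻¹ · (1 + (2ρ + 2)/(ρA₀)) · (1/K₀ + 1/(2ρ + 2))⁴ · β⁸. -/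
/-- If `β` is the larger root of `X ^ 2 - r X + 1`, then `β ^ 4` exceeds `r ^ 2 * (r ^ 2 - 4)`. -/
theorem sq_mul_sq_sub_four_lt_pow_four {r : ℝ} (hr : 2 < r) :
    r ^ 2 * (r ^ 2 - 4) < ((r + √(r ^ 2 - 4)) / 2) ^ 4 := by
  have hD : 0 < r ^ 2 - 4 := by nlinarith
  have hs := Real.sq_sqrt hD.le
  have hs0 := Real.sqrt_pos.2 hD
  generalize √(r ^ 2 - 4) = s at hs hs0
  have hrs : 0 < r * s := by positivity
  have hlt : r * s < r ^ 2 - 2 := by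
    refine lt_of_pow_lt_pow_left₀ 2 (by nlinarith) ?_
    rw [mul_pow, hs]
    nlinarith
  have hsq : r * s < ((r + s) / 2) ^ 2 := by nlinarith
  calc r ^ 2 * (r ^ 2 - 4) = (r * s) ^ 2 := by rw [mul_pow, hs]
    _ < (((r + s) / 2) ^ 2) ^ 2 := pow_lt_pow_left₀ hsq hrs.le two_ne_zero
    _ = ((r + s) / 2) ^ 4 := by ring

theorem stmt_9 (A₀ K₀ ρ A K : ℤ) (hA₀ : 2 ≤ A₀) (hK₀ : 3 ≤ K₀) (hρ : 14 ≤ ρ)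
    (hA : A₀ ≤ A) (hK : K₀ ≤ K) (hAK : A * K ≥ 2 * ρ + 4)
    (hApos : 0 < A) (hKpos : 0 < K)
    (a b c r β : ℝ)
    (ha : a = (K : ℝ)) (hb : b = (A : ℝ) ^ 2 * K - 4 * A)
    (hc : c = ((A : ℝ) + 1) ^ 2 * K - 4 * ((A : ℝ) + 1))
    (hr : r = (A : ℝ) * K - 2)
    (hβ : β = (r + Real.sqrt (a * b)) / 2) :
    b * c ^ 2 * (c - a) <
      (0.992 : ℝ)⁻¹ * (1 + (2 * (ρ : ℝ) + 2) / ((ρ : ℝ) * A₀)) *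
        (1 / (K₀ : ℝ) + 1 / (2 * (ρ : ℝ) + 2)) ^ 4 * β ^ 8 := by
  have hA₀' : (2 : ℝ) ≤ A₀ := by exact_mod_cast hA₀
  have hK₀' : (3 : ℝ) ≤ K₀ := by exact_mod_cast hK₀
  have hρ' : (14 : ℝ) ≤ ρ := by exact_mod_cast hρ
  have hA' : (A₀ : ℝ) ≤ A := by exact_mod_cast hA
  have hK' : (K₀ : ℝ) ≤ K := by exact_mod_cast hK
  have hAK' : 2 * (ρ : ℝ) + 4 ≤ A * K := by exact_mod_cast hAK
  clear hA₀ hK₀ hρ hA hK hAK hApos hKpos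
  generalize (A₀ : ℝ) = A₀ at *
  generalize (K₀ : ℝ) = K₀ at *
  generalize (ρ : ℝ) = ρ at *
  generalize (A : ℝ) = A at *
  generalize (K : ℝ) = K at *
  obtain ⟨x, hx⟩ : ∃ x, x = A * K := ⟨_, rfl⟩
  have hApos : 0 < A := by linarith
  have hKpos : 0 < K := by linarith
  have hx4 : 0 < x - 4 := by linarith
  have hx2 : 0 < x - 2 := by linarith
  have hβ4 : (x - 2) ^ 2 * (x * (x - 4)) < β ^ 4 := by
    have h := sq_mul_sq_sub_four_lt_pow_four (r := r) (by linarith)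
    have hab : a * b = r ^ 2 - 4 := by rw [ha, hb, hr]; ring
    rw [← hab, ← hβ, hab, hr, ← hx] at h
    linarith
  have hF : (1 + 2 / A + 4 / (A * (x - 4))) ≤ 1 + (2 * ρ + 2) / (ρ * A₀) := by
    have h₁ : 4 / (x - 4) ≤ 2 / ρ := by
      rw [div_le_div_iff₀ hx4 (by linarith)]
      linarith
    calc 1 + 2 / A + 4 / (A * (x - 4)) = 1 + (2 + 4 / (x - 4)) / A := by field_simp; ring
      _ ≤ 1 + (2 + 2 / ρ) / A₀ := by gcongr
      _ = 1 + (2 * ρ + 2) / (ρ * A₀) := by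
        have : ρ ≠ 0 := by linarith
        have : A₀ ≠ 0 := by linarith
        field_simp
  have hG : 1 / K + 1 / (x - 2) ≤ 1 / K₀ + 1 / (2 * ρ + 2) := by
    gcongr
    linarith
  have hmain : A * (A + 1) * (x - 4) * (x + K - 4) < (1 / K + 1 / (x - 2)) ^ 2 * β ^ 4 := by
    have hy : (x + K) * (x + K - 4) < (x + K - 2) ^ 2 := by linarith
    have hG' : (1 / K + 1 / (x - 2)) = (x + K - 2) / (K * (x - 2)) := by field_simp; ring
    rw [hG', div_pow, div_mul_eq_mul_div, lt_div_iff₀ (by positivity)]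
    calc A * (A + 1) * (x - 4) * (x + K - 4) * (K * (x - 2)) ^ 2
        = (x + K) * (x + K - 4) * ((x - 2) ^ 2 * (x * (x - 4))) := by rw [hx]; ring
      _ < (x + K - 2) ^ 2 * β ^ 4 := by
        have : 0 < (x - 2) ^ 2 * (x * (x - 4)) := by
          have : 0 < x := by linarith
          positivity
        have : 0 < (x + K) * (x + K - 4) := mul_pos (by linarith) (by linarith)
        exact mul_lt_mul'' hy hβ4 (by linarith) (by linarith)
  have hmain0 : 0 ≤ A * (A + 1) * (x - 4) * (x + K - 4) := by
    have : 0 < x + K - 4 := by linarith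
    positivity
  calc b * c ^ 2 * (c - a)
      = (1 + 2 / A + 4 / (A * (x - 4))) * (A * (A + 1) * (x - 4) * (x + K - 4)) ^ 2 := by
        have hfac : 1 + 2 / A + 4 / (A * (x - 4)) = (c - a) / (A * (x - 4)) := by
          rw [hc, ha]
          field_simp
          rw [hx]
          ring
        have hb' : b = A * (x - 4) := by rw [hb, hx]; ring
        have hc' : c = (A + 1) * (x + K - 4) := by rw [hc, hx]; ring
        rw [hfac, hb', hc']
        field_simp
    _ < (1 + 2 / A + 4 / (A * (x - 4))) * ((1 / K + 1 / (x - 2)) ^ 2 * β ^ 4) ^ 2 := by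
        gcongr
    _ = (1 + 2 / A + 4 / (A * (x - 4))) * (1 / K + 1 / (x - 2)) ^ 4 * β ^ 8 := by ring
    _ ≤ (1 + (2 * ρ + 2) / (ρ * A₀)) * (1 / K₀ + 1 / (2 * ρ + 2)) ^ 4 * β ^ 8 := by
        have : 0 ≤ 1 + 2 / A + 4 / (A * (x - 4)) := by positivity
        have : 0 ≤ 1 / K + 1 / (x - 2) := by positivity
        have : 0 ≤ β ^ 8 := by positivity
        gcongr
    _ ≤ (0.992 : ℝ)⁻¹ * (1 + (2 * ρ + 2) / (ρ * A₀)) *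
          (1 / K₀ + 1 / (2 * ρ + 2)) ^ 4 * β ^ 8 := by
        have h : (1 : ℝ) ≤ (0.992 : ℝ)⁻¹ := by norm_num
        have : 0 < ρ := by linarith
        have : 0 < A₀ := by linarith
        have : 0 < K₀ := by linarith
        simp only [mul_assoc]
        exact le_mul_of_one_le_left (by positivity) h
end

section
/- With a = K, b = A²K − 4A, c = (A+1)²K − 4(A+1), and A, K positive integers, one has (√(bc) + √(ac))/(√(bc) − √(ab)) < 1 + 5/(2A) provided one of the following holds: K = 3 and A ≥ 6; K = 5 and A ≥ 5; 6 ≤ K ≤ 11 and A ≥ 4; K ≥ 12 and A ≥ 3. -/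
theorem sqrt_ratio_lt {A a b c m n : ℝ} (hA : 0 < A) (ha : 0 < a) (hm : 0 < m) (hn : 1 < n)
    (hb : a * m ^ 2 ≤ b) (hc : a * n ^ 2 ≤ c)
    (hmn : 2 * A * n + (2 * A + 5) * m < 5 * (m * n)) :
    (√(b * c) + √(a * c)) / (√(b * c) - √(a * b)) < 1 + 5 / (2 * A) := by
  have hn0 : 0 < n := by linarith
  have hb0 : 0 < b := lt_of_lt_of_le (by positivity) hb
  have hy : √a * m ≤ √b := by
    rw [← Real.sqrt_sq hm.le, ← Real.sqrt_mul ha.le]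
    exact Real.sqrt_le_sqrt hb
  have hz : √a * n ≤ √c := by
    rw [← Real.sqrt_sq hn0.le, ← Real.sqrt_mul ha.le]
    exact Real.sqrt_le_sqrt hc
  rw [Real.sqrt_mul hb0.le, Real.sqrt_mul ha.le, Real.sqrt_mul ha.le]
  have hx0 : 0 < √a := Real.sqrt_pos.2 ha
  have hy0 : 0 < √b := Real.sqrt_pos.2 hb0
  generalize √a = x at *
  generalize √b = y at *
  generalize √c = z at *
  have hxz : x < z := by nlinarith
  have hz0 : 0 < z := hx0.trans hxz
  have key : 2 * A * (x * z) + (2 * A + 5) * (x * y) < 5 * (y * z) := by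
    refine lt_of_mul_lt_mul_left ?_ (mul_pos hm hn0).le
    calc m * n * (2 * A * (x * z) + (2 * A + 5) * (x * y))
        = 2 * A * n * z * (x * m) + (2 * A + 5) * m * y * (x * n) := by ring
      _ ≤ 2 * A * n * z * y + (2 * A + 5) * m * y * z := by gcongr
      _ = (2 * A * n + (2 * A + 5) * m) * (y * z) := by ring
      _ < 5 * (m * n) * (y * z) := by gcongr
      _ = m * n * (5 * (y * z)) := by ring
  have hD : 0 < y * z - x * y := by nlinarith [mul_pos hy0 (sub_pos.2 hxz)]
  have hs : 1 + 5 / (2 * A) = (2 * A + 5) / (2 * A) := by field_simp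
  rw [hs, div_lt_div_iff₀ hD (by positivity)]
  nlinarith

theorem stmt_10 (A K : ℤ) (hA : 0 < A) (hK : 0 < K)
    (hcase : (K = 3 ∧ A ≥ 6) ∨ (K = 5 ∧ A ≥ 5) ∨ (6 ≤ K ∧ K ≤ 11 ∧ A ≥ 4) ∨
      (K ≥ 12 ∧ A ≥ 3))
    (a b c : ℝ)
    (ha : a = (K : ℝ)) (hb : b = (A : ℝ) ^ 2 * K - 4 * A)
    (hc : c = ((A : ℝ) + 1) ^ 2 * K - 4 * ((A : ℝ) + 1)) :
    (Real.sqrt (b * c) + Real.sqrt (a * c)) / (Real.sqrt (b * c) - Real.sqrt (a * b)) <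
      1 + 5 / (2 * (A : ℝ)) := by
  have hA' : (0 : ℝ) < A := by exact_mod_cast hA
  have hK' : (0 : ℝ) < K := by exact_mod_cast hK
  suffices h : ∃ t : ℝ, t < A ∧ 4 * (A : ℝ) ≤ K * (2 * t * A - t ^ 2) ∧
      4 * ((A : ℝ) + 1) ≤ K * (2 * t * (A + 1) - t ^ 2) ∧
      2 * (A : ℝ) * (A + 1 - t) + (2 * A + 5) * (A - t) < 5 * ((A - t) * (A + 1 - t)) by
    obtain ⟨t, htA, h₁, h₂, h₃⟩ := h
    subst ha hb hc
    exact sqrt_ratio_lt hA' hK' (sub_pos.2 htA) (by linarith) (by nlinarith) (by nlinarith) h₃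
  rcases hcase with ⟨rfl, h⟩ | ⟨rfl, h⟩ | ⟨hK6, -, h⟩ | ⟨hK12, h⟩
  · have h' : (6 : ℝ) ≤ A := by exact_mod_cast h
    refine ⟨71 / 100, ?_, ?_, ?_, ?_⟩ <;> push_cast <;> nlinarith
  · have h' : (5 : ℝ) ≤ A := by exact_mod_cast h
    refine ⟨42 / 100, ?_, ?_, ?_, ?_⟩ <;> push_cast <;> nlinarith
  · have h' : (4 : ℝ) ≤ A := by exact_mod_cast h
    have hK6' : (6 : ℝ) ≤ K := by exact_mod_cast hK6
    refine ⟨35 / 100, ?_, ?_, ?_, ?_⟩ <;> nlinarith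
  · have h' : (3 : ℝ) ≤ A := by exact_mod_cast h
    have hK12' : (12 : ℝ) ≤ K := by exact_mod_cast hK12
    refine ⟨172 / 1000, ?_, ?_, ?_, ?_⟩ <;> nlinarith
end

section
/- With a = K, b = A²K + 4A, c = (A+1)²K + 4(A+1), r = AK + 2, s = (A+1)K + 2, α = (s + √(ac))/2, β = (r + √(ab))/2, and A, K positive integers, one has 1/(A + 1 + 2/K) < log(α/β) < 1/A. -/
theorem stmt_12 (A K : ℤ) (hA : 0 < A) (hK : 0 < K)
    (a b c r s α β : ℝ)
    (ha : a = (K : ℝ)) (hb : b = (A : ℝ) ^ 2 * K + 4 * A)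
    (hc : c = ((A : ℝ) + 1) ^ 2 * K + 4 * ((A : ℝ) + 1))
    (hr : r = (A : ℝ) * K + 2) (hs : s = ((A : ℝ) + 1) * K + 2)
    (hα : α = (s + Real.sqrt (a * c)) / 2)
    (hβ : β = (r + Real.sqrt (a * b)) / 2) :
    1 / ((A : ℝ) + 1 + 2 / K) < Real.log (α / β) ∧ Real.log (α / β) < 1 / (A : ℝ) := by
  have hA' : (0 : ℝ) < A := by exact_mod_cast hA
  have hK' : (0 : ℝ) < K := by exact_mod_cast hK
  generalize (A : ℝ) = x at *
  generalize (K : ℝ) = k at *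
  have hp2 : Real.sqrt (a * c) ^ 2 = s ^ 2 - 4 := by
    rw [Real.sq_sqrt (by subst ha hc; positivity)]
    subst ha hc hs
    ring
  have hq2 : Real.sqrt (a * b) ^ 2 = r ^ 2 - 4 := by
    rw [Real.sq_sqrt (by subst ha hb; positivity)]
    subst ha hb hr
    ring
  have hp0 := Real.sqrt_nonneg (a * c)
  have hq0 := Real.sqrt_nonneg (a * b)
  generalize Real.sqrt (a * c) = p at *
  generalize Real.sqrt (a * b) = q at *
  have hr0 : 0 < r := by subst hr; positivity
  have hs0 : 0 < s := by subst hs; positivity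
  have hα0 : 0 < α := by subst hα; positivity
  have hβ0 : 0 < β := by subst hβ; positivity
  have hsr : s = r + k := by subst hs hr; ring
  have hlow : s * q < r * p := by
    apply lt_of_pow_lt_pow_left₀ 2 (by positivity)
    rw [mul_pow, mul_pow, hp2, hq2]
    nlinarith
  have hup : x * p ≤ (x + 1) * q := by
    apply le_of_pow_le_pow_left₀ two_ne_zero (by positivity)
    rw [mul_pow, mul_pow, hp2, hq2, hs, hr]
    have : 0 ≤ x * (x + 1) * k := by positivity
    linarith
  constructor
  · refine lt_of_lt_of_le ?_ (Real.one_sub_inv_le_log_of_pos (div_pos hα0 hβ0))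
    have h1 : 1 / (x + 1 + 2 / k) = k / s := by
      subst hs
      field_simp
    have h2 : 1 - (α / β)⁻¹ = (α - β) / α := by
      field_simp
    rw [h1, h2, div_lt_div_iff₀ hs0 hα0, hα, hβ]
    subst hsr
    linarith
  · refine lt_of_le_of_lt (Real.log_le_sub_one_of_pos (div_pos hα0 hβ0)) ?_
    have h2 : α / β - 1 = (α - β) / β := by
      field_simp
    rw [h2, div_lt_div_iff₀ hβ0 hA', hα, hβ, hs, hr]
    linarith
end
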